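/- arXiv:2002.11981 — 3 statements merged into one kernel-verified Lean document; each statement's English description precedes it below -/
import Mathlib

section
/- Let k be an algebraically closed field of characteristic zero, let A be an abelian variety over k, and let X ⊂ A be a closed subvariety. Then X is groupless over k if and only if the special locus Sp(X) — the union of translates of positive-dimensional abelian subvarieties of A contained in X — is empty. -/
/-!
Formalization of a statement from "The Lang–Vojta conjectures on projective
pseudo-hyperbolic varieties" (Javanpeykar).

Notions not available in Mathlib (analytifications, genus, ample degrees, Hom-schemes, ...)
are encoded by explicit definitions or structures below; see the docstrings for the
conventions used.
-/

open CategoryTheory AlgebraicGeometry Limits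

noncomputable section

/-- `Spec R` as a scheme, for a commutative ring `R`. -/
abbrev SR (R : Type) [CommRing R] : Scheme := Spec (CommRingCat.of R)

/-- The category of schemes over `Spec R`. -/
abbrev OverR (R : Type) [CommRing R] := Over (SR R)

/-- A morphism of schemes over `Spec R` is constant if it factors through the base `Spec R`. -/
def IsConstant {R : Type} [CommRing R] {X Y : OverR R} (f : X ⟶ Y) : Prop :=
  ∃ y : SR R ⟶ Y.left, f.left = X.hom ≫ y

/-- A morphism `g : V ⟶ W` of schemes, where `V` has structure morphism `sV` to `Spec R`,
is constant if it factors through `Spec R`. -/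
def IsConstantHom {R : Type} [CommRing R] {V W : Scheme} (sV : V ⟶ SR R) (g : V ⟶ W) : Prop :=
  ∃ y : SR R ⟶ W, g = sV ≫ y

/-- A variety over `R`: a finite type, separated scheme over `Spec R`. -/
def IsVarietyOver {R : Type} [CommRing R] (X : OverR R) : Prop :=
  LocallyOfFiniteType X.hom ∧ QuasiCompact X.hom ∧ IsSeparated X.hom

/-- The multiplicative group scheme `𝔾ₘ` over `R`, i.e. the spectrum of the Laurent
polynomial ring over `R` (only its underlying scheme over `Spec R` is needed). -/
def GmO (R : Type) [CommRing R] : OverR R :=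
  Over.mk (Spec.map (CommRingCat.ofHom (algebraMap R (LaurentPolynomial R))))

/-- The affine line over `R`. -/
def A1O (R : Type) [CommRing R] : OverR R :=
  Over.mk (Spec.map (CommRingCat.ofHom (algebraMap R (Polynomial R))))

/-- `Spec R` as the terminal object of the category of schemes over `Spec R`. -/
def ptO (R : Type) [CommRing R] : OverR R := Over.mk (𝟙 (SR R))

/-- A group scheme over `R`, presented via a group structure on its functor of points:
by the Yoneda lemma this is the same as a group object in the category of schemes
over `Spec R`. -/
structure GroupScheme (R : Type) [CommRing R] where
  G : OverR R
  mul : ∀ {T : OverR R}, (T ⟶ G) → (T ⟶ G) → (T ⟶ G)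
  one : ∀ (T : OverR R), T ⟶ G
  inv : ∀ {T : OverR R}, (T ⟶ G) → (T ⟶ G)
  mul_assoc : ∀ {T : OverR R} (a b c : T ⟶ G), mul (mul a b) c = mul a (mul b c)
  one_mul : ∀ {T : OverR R} (a : T ⟶ G), mul (one T) a = a
  inv_mul : ∀ {T : OverR R} (a : T ⟶ G), mul (inv a) a = one T
  mul_natural : ∀ {T T' : OverR R} (f : T ⟶ T') (a b : T' ⟶ G),
    f ≫ mul a b = mul (f ≫ a) (f ≫ b)
  one_natural : ∀ {T T' : OverR R} (f : T ⟶ T'), f ≫ one T' = one T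

/-- A finite type, connected group scheme over `R`. -/
def GroupScheme.IsFiniteTypeConnected {R : Type} [CommRing R] (Γ : GroupScheme R) : Prop :=
  LocallyOfFiniteType Γ.G.hom ∧ QuasiCompact Γ.G.hom ∧ ConnectedSpace Γ.G.left

/-- An abelian variety over `R`: a connected finite type proper group scheme. (Over an
algebraically closed field of characteristic zero this agrees with the usual definition,
since group schemes are then automatically smooth by Cartier's theorem.) -/
def GroupScheme.IsAbelianVariety {R : Type} [CommRing R] (Γ : GroupScheme R) : Prop :=
  Γ.IsFiniteTypeConnected ∧ IsProper Γ.G.hom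

/-- A scheme over `R` is groupless if every morphism to it from `𝔾ₘ` and from any abelian
variety over `R` is constant. -/
def IsGroupless (R : Type) [CommRing R] (X : OverR R) : Prop :=
  (∀ f : GmO R ⟶ X, IsConstant f) ∧
  (∀ Γ : GroupScheme R, Γ.IsAbelianVariety → ∀ f : Γ.G ⟶ X, IsConstant f)

/-- A subset `Z` of a topological space has codimension at least two: every point of
`Z` admits a chain of two strict generizations (this computes the codimension of the
closure of each point of `Z` via the specialization order). -/
def CodimAtLeastTwo {T : Type} [TopologicalSpace T] (Z : Set T) : Prop :=
  ∀ z ∈ Z, ∃ x y : T, x ⤳ y ∧ y ⤳ z ∧ ¬(y ⤳ x) ∧ ¬(z ⤳ y)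

/-- `X` is groupless modulo the closed subset `Δ` if for every finite type connected group
scheme `G` over `R` and every dense open `U ⊆ G` whose complement has codimension at least
two, every non-constant morphism `U ⟶ X` over `R` factors over `Δ`. -/
def GrouplessModulo (R : Type) [CommRing R] (X : OverR R) (Δ : Set X.left) : Prop :=
  ∀ (Γ : GroupScheme R), Γ.IsFiniteTypeConnected →
    ∀ (U : Γ.G.left.Opens), Dense (U : Set Γ.G.left) →
      CodimAtLeastTwo ((U : Set Γ.G.left)ᶜ) →
      ∀ g : U.toScheme ⟶ X.left, g ≫ X.hom = U.ι ≫ Γ.G.hom →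
        ¬ IsConstantHom (U.ι ≫ Γ.G.hom) g → Set.range g.base ⊆ Δ

/-- `X` is pseudo-groupless if it is groupless modulo some proper closed subset. -/
def PseudoGroupless (R : Type) [CommRing R] (X : OverR R) : Prop :=
  ∃ Δ : Set X.left, IsClosed Δ ∧ Δ ≠ Set.univ ∧ GrouplessModulo R X Δ

section
/-! ### Elementary group-functor calculus -/

/-- The group structure on `T`-points. -/
instance GroupScheme.instGroup {R : Type} [CommRing R] (Γ : GroupScheme R) (T : OverR R) :
    Group (T ⟶ Γ.G) :=
  letI : Mul (T ⟶ Γ.G) := ⟨Γ.mul⟩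
  letI : One (T ⟶ Γ.G) := ⟨Γ.one T⟩
  letI : Inv (T ⟶ Γ.G) := ⟨Γ.inv⟩
  Group.ofLeftAxioms Γ.mul_assoc Γ.one_mul Γ.inv_mul

namespace GroupScheme
variable {R : Type} [CommRing R] (Γ : GroupScheme R)

lemma mul_def {T : OverR R} (a b : T ⟶ Γ.G) : Γ.mul a b = a * b := rfl

lemma comp_mul {T T' : OverR R} (f : T ⟶ T') (a b : T' ⟶ Γ.G) :
    f ≫ (a * b) = (f ≫ a) * (f ≫ b) := Γ.mul_natural f a b

lemma comp_one {T T' : OverR R} (f : T ⟶ T') :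
    f ≫ (1 : T' ⟶ Γ.G) = 1 := Γ.one_natural f

lemma comp_inv {T T' : OverR R} (f : T ⟶ T') (a : T' ⟶ Γ.G) :
    f ≫ a⁻¹ = (f ≫ a)⁻¹ := by
  rw [eq_inv_iff_mul_eq_one, ← Γ.comp_mul, inv_mul_cancel, Γ.comp_one]

end GroupScheme

/-- The structure morphism as a morphism to the terminal object. -/
def toPt {R : Type} [CommRing R] (T : OverR R) : T ⟶ ptO R := Over.homMk T.hom (by simp [ptO])

lemma comp_toPt {R : Type} [CommRing R] {T T' : OverR R} (f : T ⟶ T') :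
    f ≫ toPt T' = toPt T := by
  ext1; exact Over.w f

@[simp] lemma toPt_left {R : Type} [CommRing R] (T : OverR R) : (toPt T).left = T.hom := rfl

lemma isConstant_iff {R : Type} [CommRing R] {X Y : OverR R} [Epi X.hom] (f : X ⟶ Y) :
    IsConstant f ↔ ∃ y : ptO R ⟶ Y, f = toPt X ≫ y := by
  constructor
  · rintro ⟨y, hy⟩
    refine ⟨Over.homMk y ?_, ?_⟩
    · have := Over.w f
      rw [hy, Category.assoc] at this
      exact (cancel_epi X.hom).1 (this.trans (Category.comp_id _).symm)
    · ext1; exact hy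
  · rintro ⟨y, rfl⟩
    exact ⟨y.left, rfl⟩

lemma IsConstant.of_eq {R : Type} [CommRing R] {X Y : OverR R} {f : X ⟶ Y} {y : ptO R ⟶ Y}
    (h : f = toPt X ≫ y) : IsConstant f := ⟨y.left, by rw [h]; rfl⟩

/-- `Spec S` over `Spec R`. -/
abbrev SpO (R : Type) [CommRing R] (S : Type) [CommRing S] [Algebra R S] : OverR R :=
  Over.mk (Spec.map (CommRingCat.ofHom (algebraMap R S)))

/-- Spec of an algebra map. -/
def SpO.map {R : Type} [CommRing R] {S S' : Type} [CommRing S] [Algebra R S] [CommRing S']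
    [Algebra R S'] (f : S →ₐ[R] S') : SpO R S' ⟶ SpO R S :=
  Over.homMk (Spec.map (CommRingCat.ofHom f.toRingHom)) (by
    simp only [SpO, Over.mk_left, Over.mk_hom, ← Spec.map_comp, ← CommRingCat.ofHom_comp]
    congr 2
    exact f.comp_algebraMap)

lemma SpO.map_comp {R : Type} [CommRing R] {S S' S'' : Type} [CommRing S] [Algebra R S]
    [CommRing S'] [Algebra R S'] [CommRing S''] [Algebra R S'']
    (f : S →ₐ[R] S') (g : S' →ₐ[R] S'') : SpO.map (g.comp f) = SpO.map g ≫ SpO.map f := by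
  ext1
  exact Spec.map_comp (CommRingCat.ofHom f.toRingHom) (CommRingCat.ofHom g.toRingHom)

lemma SpO.map_id {R : Type} [CommRing R] {S : Type} [CommRing S] [Algebra R S] :
    SpO.map (AlgHom.id R S) = 𝟙 _ := by
  ext1
  exact Spec.map_id _

lemma SpO.map_left {R : Type} [CommRing R] {S S' : Type} [CommRing S] [Algebra R S] [CommRing S']
    [Algebra R S'] (f : S →ₐ[R] S') :
    (SpO.map f).left = Spec.map (CommRingCat.ofHom f.toRingHom) := rfl

lemma SpO.map_injective {R : Type} [CommRing R] {S S' : Type} [CommRing S] [Algebra R S]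
    [CommRing S'] [Algebra R S'] {f g : S →ₐ[R] S'} (h : SpO.map f = SpO.map g) : f = g := by
  have h1 := congrArg (fun x => x.left) h
  simp only [SpO.map_left] at h1
  have h2 := Spec.map_injective h1
  have h3 := congrArg CommRingCat.Hom.hom h2
  ext x
  exact congrArg (fun q : S →+* S' => q x) h3

/-- Morphisms between spectra over the base come from algebra maps. -/
lemma SpO.exists_eq_map {R : Type} [CommRing R] {S S' : Type} [CommRing S] [Algebra R S]
    [CommRing S'] [Algebra R S'] (g : SpO R S' ⟶ SpO R S) : ∃ f : S →ₐ[R] S', g = SpO.map f := by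
  obtain ⟨φ, hφ⟩ : ∃ φ : CommRingCat.of S ⟶ CommRingCat.of S', g.left = Spec.map φ :=
    ⟨Spec.preimage g.left, (Spec.map_preimage _).symm⟩
  have hw := Over.w g
  rw [hφ] at hw
  simp only [SpO, Over.mk_hom] at hw
  rw [← Spec.map_comp] at hw
  have hw2 := congrArg CommRingCat.Hom.hom (Spec.map_injective hw)
  refine ⟨{ φ.hom with commutes' := fun r => congrArg (fun q : R →+* S' => q r) hw2 }, ?_⟩
  ext1
  exact hφ

end

section
/-! ### The theorem of Cartier: the algebra -/

/-- The nilradical is stable under derivations in characteristic zero. -/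
lemma derivation_mem_nilradical {k R : Type} [Field k] [CharZero k] [CommRing R] [Algebra k R]
    (D : Derivation k R R) {f : R} (hf : f ∈ nilradical R) : D f ∈ nilradical R := by
  obtain ⟨n, hn⟩ := (mem_nilradical.1 hf)
  have key : ∀ j, j ≤ n → f ^ (n - j) * (D f) ^ (2 * j) = 0 := by
    intro j
    induction j with
    | zero => intro _; simpa using hn
    | succ j ih =>
      intro hj
      have h0 := ih (by omega)
      obtain ⟨m, hm⟩ : ∃ m, n - j = m + 1 := ⟨n - j - 1, by omega⟩
      have hm' : n - (j + 1) = m := by omega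
      rw [hm] at h0
      rw [hm']
      have h1 := congrArg D h0
      rw [Derivation.leibniz, map_zero, Derivation.leibniz_pow, Derivation.leibniz_pow] at h1
      simp only [smul_eq_mul, nsmul_eq_mul, Nat.add_sub_cancel] at h1
      have h2 := congrArg (fun z => D f * z) h1
      simp only [mul_zero] at h2
      have h3 : ((m + 1 : ℕ) : R) * (f ^ m * (D f) ^ (2 * (j + 1))) = 0 := by
        rcases Nat.eq_zero_or_pos j with rfl | hj0
        · simp at h2 ⊢
          linear_combination h2
        · have e : D f * (D f) ^ (2 * j - 1) = (D f) ^ (2 * j) := by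
            rw [← pow_succ']; congr 1; omega
          have e2 : (D f) ^ (2 * (j + 1)) = (D f) ^ (2 * j) * D f * D f := by ring
          rw [e2]
          linear_combination h2 - ((2 * j : ℕ) : R) * D (D f) * h0 -
            f ^ (m + 1) * ((2 * j : ℕ) : R) * D (D f) * e
      have hu : IsUnit ((m + 1 : ℕ) : R) := by
        have : ((m + 1 : ℕ) : R) = algebraMap k R ((m + 1 : ℕ) : k) := by simp
        rw [this]
        exact (IsUnit.mk0 _ (by exact_mod_cast Nat.succ_ne_zero m)).map _
      exact (hu.mul_right_eq_zero).1 h3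
  have := key n le_rfl
  rw [Nat.sub_self, pow_zero, one_mul] at this
  exact mem_nilradical.2 ⟨_, this⟩


/-- Existence of an Euler derivation. -/
lemma exists_euler {k R : Type} [Field k] [CommRing R] [IsNoetherianRing R]
    [Algebra k R] (aug : R →ₐ[k] k)
    (hD : ∀ v : R →ₗ[k] k, (∀ x y, v (x * y) = aug x * v y + aug y * v x) →
      ∃ D : Derivation k R R, ∀ x, aug (D x) = v x) :
    ∃ (s : Finset (R × Derivation k R R)), (∀ p ∈ s, p.1 ∈ RingHom.ker aug) ∧
      ∀ y ∈ RingHom.ker aug, (∑ p ∈ s, p.1 * p.2 y) - y ∈ (RingHom.ker aug) ^ 2 := by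
  classical
  set m : Ideal R := RingHom.ker aug with hm
  have haug : ∀ x : R, x - algebraMap k R (aug x) ∈ m := fun x => by
    rw [hm, RingHom.mem_ker]; simp
  have hsm : ∀ (r : R) (w : m.Cotangent), r • w = aug r • w := fun r w => by
    have := Ideal.Cotangent.smul_eq_zero_of_mem (haug r) w
    rw [sub_smul, sub_eq_zero] at this
    rw [this, algebraMap_smul]
  have hfin : Module.Finite k m.Cotangent := by
    have : Module.Finite R m.Cotangent :=
      Module.Finite.of_surjective m.toCotangent m.toCotangent_surjective
    obtain ⟨S, hS⟩ := this.fg_top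
    refine ⟨⟨S, ?_⟩⟩
    rw [eq_top_iff]
    intro w _
    have hw : w ∈ Submodule.span R (S : Set m.Cotangent) := by rw [hS]; trivial
    induction hw using Submodule.span_induction with
    | mem x hx => exact Submodule.subset_span hx
    | zero => exact zero_mem _
    | add x y _ _ hx hy => exact add_mem (hx trivial) (hy trivial)
    | smul r x _ hx => rw [hsm]; exact Submodule.smul_mem _ _ (hx trivial)
  let b := Module.finBasis k m.Cotangent
  let pr : R →ₗ[k] m :=
    { toFun := fun x => ⟨x - algebraMap k R (aug x), haug x⟩
      map_add' := fun x y => Subtype.ext (by simp; ring)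
      map_smul' := fun c x => Subtype.ext (by
        simp [Algebra.smul_def, mul_sub]) }
  let q : R →ₗ[k] m.Cotangent := (m.toCotangent.restrictScalars k).comp pr
  have hq : ∀ x y, q (x * y) = aug x • q y + aug y • q x := fun x y => by
    have h1 : aug x • q y + aug y • q x = m.toCotangent (aug x • pr y + aug y • pr x) := by
      rw [map_add]
      exact congrArg₂ (· + ·) (((m.toCotangent.restrictScalars k).map_smul _ _).symm)
        (((m.toCotangent.restrictScalars k).map_smul _ _).symm)
    rw [h1]
    refine m.toCotangent_eq.2 ?_
    have : ((pr (x * y) : m) : R) - ((aug x • pr y + aug y • pr x : m) : R) =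
        (x - algebraMap k R (aug x)) * (y - algebraMap k R (aug y)) := by
      simp [pr, Algebra.smul_def]; ring
    rw [this, pow_two]
    exact Ideal.mul_mem_mul (haug x) (haug y)
  have hex : ∀ i, ∃ D : Derivation k R R, ∀ x, aug (D x) = b.coord i (q x) := fun i =>
    hD ((b.coord i).comp q) (fun x y => by simp [hq])
  choose D hDi using hex
  choose x hx using fun i => m.toCotangent_surjective (b i)
  let s : Finset (R × Derivation k R R) :=
    Finset.univ.image (fun i => (((x i : m) : R), D i))
  have hinj : Function.Injective (fun i => (((x i : m) : R), D i)) := by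
    intro i j hij
    have h1 : x i = x j := Subtype.ext (congrArg Prod.fst hij)
    apply b.injective
    rw [← hx, ← hx, h1]
  refine ⟨s, ?_, ?_⟩
  · intro p hp
    obtain ⟨i, _, rfl⟩ := Finset.mem_image.1 hp
    exact (x i).2
  · intro y hy
    rw [Finset.sum_image (fun i _ j _ h => hinj h)]
    have h1 : q y = m.toCotangent ⟨y, hy⟩ := by
      refine m.toCotangent_eq.2 ?_
      have h0 : aug y = 0 := hy
      simp [pr, h0]
    have h2 : q y = m.toCotangent (∑ i, (D i y) • x i) := by
      rw [map_sum]
      conv_lhs => rw [← b.sum_repr (q y)]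
      refine Finset.sum_congr rfl fun i _ => ?_
      rw [map_smul, hsm, hx, hDi]; rfl
    have h3 := m.toCotangent_eq.1 (h2.symm.trans h1)
    convert h3 using 2
    simp [mul_comm]

/-- The algebraic part of The theorem of Cartier. -/
lemma isReduced_of_lift_derivations {k R : Type} [Field k] [CharZero k] [CommRing R]
    [IsNoetherianRing R] [IsLocalRing R] [Algebra k R] (aug : R →ₐ[k] k)
    (hD : ∀ v : R →ₗ[k] k, (∀ x y, v (x * y) = aug x * v y + aug y * v x) →
      ∃ D : Derivation k R R, ∀ x, aug (D x) = v x) : IsReduced R := by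
  obtain ⟨s, hs, hE⟩ := exists_euler aug hD
  set m : Ideal R := RingHom.ker aug with hm
  let E : R → R := fun y => ∑ p ∈ s, p.1 * p.2 y
  have hEadd : ∀ x y, E (x + y) = E x + E y := fun x y => by
    simp [E, mul_add, Finset.sum_add_distrib]
  have hEmul : ∀ x y, E (x * y) = x * E y + y * E x := fun x y => by
    simp only [E, Finset.mul_sum, ← Finset.sum_add_distrib]
    refine Finset.sum_congr rfl fun p _ => ?_
    simp; ring
  have key : ∀ n : ℕ, ∀ f ∈ m ^ n, E f - n * f ∈ m ^ (n + 1) := by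
    intro n
    induction n with
    | zero =>
      intro f _
      simp only [Nat.cast_zero, zero_mul, sub_zero, zero_add, pow_one]
      exact Ideal.sum_mem _ fun p hp => Ideal.mul_mem_right _ _ (hs p hp)
    | succ n ih =>
      intro f hf
      rw [pow_succ'] at hf
      induction hf using Submodule.mul_induction_on' with
      | mem_mul_mem y hy g hg =>
        have h1 : y * (E g - n * g) ∈ m ^ (n + 1 + 1) := by
          rw [pow_succ']; exact Ideal.mul_mem_mul hy (ih g hg)
        have h2 : g * (E y - y) ∈ m ^ (n + 1 + 1) := by
          have : m ^ (n + 1 + 1) = m ^ n * m ^ 2 := by rw [← pow_add]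
          rw [this]; exact Ideal.mul_mem_mul hg (hE y hy)
        have := add_mem h1 h2
        rw [hEmul]
        convert this using 1
        push_cast; ring
      | add x _ y _ hx hy =>
        rw [hEadd]
        convert add_mem hx hy using 1
        ring
  have hunit : ∀ n : ℕ, IsUnit ((n + 1 : ℕ) : R) := fun n => by
    have : ((n + 1 : ℕ) : R) = algebraMap k R ((n + 1 : ℕ) : k) := by simp
    rw [this]
    exact (IsUnit.mk0 _ (by exact_mod_cast Nat.succ_ne_zero n)).map _
  have hmtop : m ≠ ⊤ := RingHom.ker_ne_top aug.toRingHom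
  have hN : ∀ n : ℕ, nilradical R ≤ m ^ (n + 1) := by
    intro n
    induction n with
    | zero =>
      intro f hf
      rw [zero_add, pow_one, hm, RingHom.mem_ker]
      exact ((mem_nilradical.1 hf).map aug).eq_zero
    | succ n ih =>
      intro f hf
      have h1 := key (n + 1) f (ih hf)
      have h2 : E f ∈ m ^ (n + 1 + 1) := by
        refine Ideal.sum_mem _ fun p hp => ?_
        rw [pow_succ']
        exact Ideal.mul_mem_mul (hs p hp) (ih (derivation_mem_nilradical p.2 hf))
      have h3 := sub_mem h2 h1
      rw [sub_sub_cancel] at h3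
      exact (Ideal.unit_mul_mem_iff_mem _ (hunit n)).1 h3
  have : nilradical R = ⊥ := by
    rw [eq_bot_iff, ← Ideal.iInf_pow_eq_bot_of_isLocalRing m hmtop]
    refine le_iInf fun n => ?_
    exact (hN n).trans (Ideal.pow_le_pow_right (Nat.le_succ n))
  rwa [nilradical_eq_bot_iff] at this

end

section
/-! ### Local rings as pro-representing objects -/

/-- The local ring at a point of a scheme over a base, with its universal property. -/
lemma exists_localRing {k : Type} [CommRing k] (X : OverR k) (x : X.left) :
    ∃ (O : Type) (_ : CommRing O) (_ : IsLocalRing O) (_ : Algebra k O) (c : SpO k O ⟶ X),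
      Mono c ∧ c.left (IsLocalRing.closedPoint O) = x ∧
      (∀ (S : Type) [CommRing S] [IsLocalRing S] [Algebra k S] (f : SpO k S ⟶ X),
        f.left (IsLocalRing.closedPoint S) = x → ∃ φ : O →ₐ[k] S, IsLocalHom φ ∧
          f = SpO.map φ ≫ c) ∧
      Nonempty (O ≃+* X.left.presheaf.stalk x) := by
  let g : CommRingCat.of k ⟶ X.left.presheaf.stalk x :=
    Spec.preimage (X.left.fromSpecStalk x ≫ X.hom)
  have hg : Spec.map g = X.left.fromSpecStalk x ≫ X.hom := Spec.map_preimage _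
  let _ : Algebra k (X.left.presheaf.stalk x) := g.hom.toAlgebra
  have hc : X.left.fromSpecStalk x ≫ X.hom = (SpO k (X.left.presheaf.stalk x)).hom := hg.symm
  let c : SpO k (X.left.presheaf.stalk x) ⟶ X := Over.homMk (X.left.fromSpecStalk x) hc
  have hm : Mono c := by
    have : Mono c.left := inferInstanceAs (Mono (X.left.fromSpecStalk x))
    exact Over.mono_of_mono_left c
  refine ⟨X.left.presheaf.stalk x, inferInstance, inferInstance, inferInstance, c, hm,
    Scheme.fromSpecStalk_closedPoint, ?_, ⟨RingEquiv.refl _⟩⟩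
  intro S _ _ _ f hf
  subst hf
  let φ := Scheme.stalkClosedPointTo (R := CommRingCat.of S) f.left
  have hφ : Spec.map φ ≫ X.left.fromSpecStalk _ = f.left :=
    Scheme.Spec_stalkClosedPointTo_fromSpecStalk f.left
  have hw : Spec.map (g ≫ φ) = Spec.map (CommRingCat.ofHom (algebraMap k S)) := by
    rw [Spec.map_comp, hg, reassoc_of% hφ]; exact Over.w f
  have hw2 := congrArg CommRingCat.Hom.hom (Spec.map_injective hw)
  refine ⟨{ φ.hom with commutes' := fun r => congrArg (fun q : k →+* S => q r) hw2 }, ?_, ?_⟩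
  · have : IsLocalHom φ.hom := inferInstance
    exact ⟨fun a ha => this.map_nonunit a ha⟩
  · ext1
    exact hφ.symm

/-- Functoriality of dual numbers. -/
def dualMap {k S S' : Type} [CommRing k] [CommRing S] [Algebra k S] [CommRing S'] [Algebra k S']
    (f : S →ₐ[k] S') : DualNumber S →ₐ[k] DualNumber S' where
  toFun x := TrivSqZeroExt.inl (f x.fst) + TrivSqZeroExt.inr (f x.snd)
  map_one' := TrivSqZeroExt.ext (by simp) (by simp)
  map_zero' := TrivSqZeroExt.ext (by simp) (by simp)
  map_add' x y := TrivSqZeroExt.ext (by simp) (by simp)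
  map_mul' x y := TrivSqZeroExt.ext (by simp) (by simp)
  commutes' r := TrivSqZeroExt.ext (by simp [TrivSqZeroExt.algebraMap_eq_inl'])
    (by simp [TrivSqZeroExt.algebraMap_eq_inl'])

/-- The inclusion of constants. -/
def dualInl (k S : Type) [CommRing k] [CommRing S] [Algebra k S] : S →ₐ[k] DualNumber S :=
  TrivSqZeroExt.inlAlgHom k S S

/-- Reduction modulo `ε`. -/
def dualFst (k S : Type) [CommRing k] [CommRing S] [Algebra k S] : DualNumber S →ₐ[k] S :=
  TrivSqZeroExt.fstHom k S S

@[simp] lemma dualMap_fst {k S S' : Type} [CommRing k] [CommRing S] [Algebra k S] [CommRing S']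
    [Algebra k S'] (f : S →ₐ[k] S') (x) : (dualMap f x).fst = f x.fst := by
  simp [dualMap]
@[simp] lemma dualMap_snd {k S S' : Type} [CommRing k] [CommRing S] [Algebra k S] [CommRing S']
    [Algebra k S'] (f : S →ₐ[k] S') (x) : (dualMap f x).snd = f x.snd := by
  simp [dualMap]
@[simp] lemma dualInl_fst {k S : Type} [CommRing k] [CommRing S] [Algebra k S] (x : S) :
  (dualInl k S x).fst = x := rfl
@[simp] lemma dualInl_snd {k S : Type} [CommRing k] [CommRing S] [Algebra k S] (x : S) :
  (dualInl k S x).snd = 0 := rfl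
@[simp] lemma dualFst_apply {k S : Type} [CommRing k] [CommRing S] [Algebra k S]
    (x : DualNumber S) : dualFst k S x = x.fst := rfl

instance dualNumber_isLocalRing {S : Type} [CommRing S] [IsLocalRing S] :
    IsLocalRing (DualNumber S) := by
  refine IsLocalRing.of_nonunits_add fun a b ha hb => ?_
  simp only [mem_nonunits_iff, TrivSqZeroExt.isUnit_iff_isUnit_fst, TrivSqZeroExt.fst_add] at *
  exact IsLocalRing.nonunits_add ha hb

lemma dualFst_closedPoint {k S : Type} [CommRing k] [CommRing S] [IsLocalRing S] [Algebra k S] :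
    (SpO.map (dualFst k S)).left (IsLocalRing.closedPoint S) =
      IsLocalRing.closedPoint (DualNumber S) := by
  have : IsLocalHom (dualFst k S).toRingHom :=
    ⟨fun a ha => TrivSqZeroExt.isUnit_iff_isUnit_fst.2 ha⟩
  exact IsLocalRing.comap_closedPoint (dualFst k S).toRingHom

/-- The morphism to `Spec k`. -/
abbrev SpO.toK (k S : Type) [CommRing k] [CommRing S] [Algebra k S] : SpO k S ⟶ SpO k k :=
  SpO.map (Algebra.ofId k S)

/-- Local rings at rational points of group schemes are reduced. -/
lemma cartier_local {k : Type} [Field k] [CharZero k] (Γ : GroupScheme k) (p : SpO k k ⟶ Γ.G)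
    (x : Γ.G.left) (hx : p.left (IsLocalRing.closedPoint k) = x)
    [IsNoetherianRing (Γ.G.left.presheaf.stalk x)] :
    IsReduced (Γ.G.left.presheaf.stalk x) := by
  obtain ⟨O, _, _, _, c, hc, hcx, hO, ⟨e⟩⟩ := exists_localRing Γ.G x
  have : IsNoetherianRing O := isNoetherianRing_of_ringEquiv _ e.symm
  suffices h : IsReduced O from isReduced_of_injective e.symm e.symm.injective
  obtain ⟨aug, -, haug⟩ := hO k p hx
  refine isReduced_of_lift_derivations aug fun v hv => ?_
  have hv1 : v 1 = 0 := by simpa using hv 1 1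
  let V : O →ₐ[k] DualNumber k :=
    { toFun := fun y => TrivSqZeroExt.inl (aug y) + TrivSqZeroExt.inr (v y)
      map_one' := TrivSqZeroExt.ext (by simp) (by simp [hv1])
      map_zero' := TrivSqZeroExt.ext (by simp) (by simp)
      map_add' := fun x y => TrivSqZeroExt.ext (by simp) (by simp)
      map_mul' := fun x y => TrivSqZeroExt.ext (by simp) (by simp [hv, mul_comm])
      commutes' := fun r => TrivSqZeroExt.ext (by simp [TrivSqZeroExt.algebraMap_eq_inl'])
        (by simp [TrivSqZeroExt.algebraMap_eq_inl', Algebra.algebraMap_eq_smul_one, hv1]) }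
  let b : SpO k (DualNumber k) ⟶ Γ.G := (SpO.toK k (DualNumber k) ≫ p)⁻¹ * (SpO.map V ≫ c)
  have hb : SpO.map (dualFst k k) ≫ b = 1 := by
    rw [Γ.comp_mul, Γ.comp_inv, ← Category.assoc, ← Category.assoc, ← SpO.map_comp,
      ← SpO.map_comp]
    have h1 : (dualFst k k).comp (Algebra.ofId k (DualNumber k)) = AlgHom.id k k :=
      Subsingleton.elim _ _
    have h2 : (dualFst k k).comp V = aug := by ext; simp [V]
    rw [h1, h2, SpO.map_id, Category.id_comp, ← haug, inv_mul_cancel]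
  let P : SpO k (DualNumber O) ⟶ Γ.G :=
    (SpO.map (dualInl k O) ≫ c) * (SpO.map (dualMap (Algebra.ofId k O)) ≫ b)
  have hP1 : SpO.map (dualFst k O) ≫ P = c := by
    rw [Γ.comp_mul, ← Category.assoc, ← Category.assoc, ← SpO.map_comp, ← SpO.map_comp]
    have h1 : (dualFst k O).comp (dualInl k O) = AlgHom.id k O := rfl
    have h2 : (dualFst k O).comp (dualMap (Algebra.ofId k O)) =
      (Algebra.ofId k O).comp (dualFst k k) := by
        apply AlgHom.ext; intro y; simp [Algebra.ofId_apply]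
    rw [h1, h2, SpO.map_id, Category.id_comp, SpO.map_comp, Category.assoc, hb, Γ.comp_one,
      mul_one]
  have hPx : P.left (IsLocalRing.closedPoint (DualNumber O)) = x := by
    rw [← dualFst_closedPoint (k := k), ← hcx]
    conv_rhs => rw [← hP1]
    simp
    rfl
  obtain ⟨φ, -, hφ⟩ := hO _ P hPx
  have hφ1 : (dualFst k O).comp φ = AlgHom.id k O := by
    apply SpO.map_injective
    rw [← cancel_mono c, SpO.map_comp, Category.assoc, ← hφ, hP1, SpO.map_id, Category.id_comp]
  have hφ2 : (dualMap aug).comp φ = V := by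
    apply SpO.map_injective
    rw [← cancel_mono c, SpO.map_comp, Category.assoc, ← hφ, Γ.comp_mul, ← Category.assoc,
      ← Category.assoc, ← SpO.map_comp, ← SpO.map_comp]
    have h1 : (dualMap aug).comp (dualInl k O) = (Algebra.ofId k (DualNumber k)).comp aug := by
      ext y
      · simp [Algebra.ofId_apply, TrivSqZeroExt.algebraMap_eq_inl']
      · simp [Algebra.ofId_apply, TrivSqZeroExt.algebraMap_eq_inl']
    have h2 : (dualMap aug).comp (dualMap (Algebra.ofId k O)) = AlgHom.id k _ := by
      apply AlgHom.ext; intro y; apply TrivSqZeroExt.ext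
      · simp [Algebra.ofId_apply]
      · simp [Algebra.ofId_apply]
    rw [h1, h2, SpO.map_id, Category.id_comp, SpO.map_comp, Category.assoc, ← haug]
    exact mul_inv_cancel_left _ _
  have hfst : ∀ y, (φ y).fst = y := fun y => congrArg (fun q : O →ₐ[k] O => q y) hφ1
  refine ⟨Derivation.mk' 
    { toFun := fun y => (φ y).snd
      map_add' := fun x y => by simp
      map_smul' := fun r y => by simp } (fun a b => ?_), fun y => ?_⟩
  · simp [hfst, mul_comm]
  · have := congrArg (fun q : O →ₐ[k] DualNumber k => (q y).snd) hφ2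
    simpa [V] using this

end

section
/-! ### Group schemes over algebraically closed fields of characteristic zero -/

lemma isReduced_of_isReduced_stalk_closedPoint {X : Scheme.{0}} [JacobsonSpace X]
    (h : ∀ x : X, IsClosed {x} → _root_.IsReduced (X.presheaf.stalk x)) : IsReduced X := by
  refine ⟨fun U => ⟨fun s hs => ?_⟩⟩
  let W : Set X := {x | ∃ (V : X.Opens) (_ : x ∈ V) (i : V ⟶ U), X.presheaf.map i.op s = 0}
  have hW : IsOpen W := by
    rw [isOpen_iff_forall_mem_open]
    rintro x ⟨V, hxV, i, hV⟩
    exact ⟨V, fun y hy => ⟨V, hy, i, hV⟩, V.isOpen, hxV⟩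
  have hUW : (U : Set X) ⊆ W := by
    rw [← Set.sdiff_eq_empty, ← Set.not_nonempty_iff_eq_empty]
    intro H
    obtain ⟨x, ⟨hxU, hxW⟩, hx⟩ := nonempty_inter_closedPoints H (by
      rw [Set.sdiff_eq_compl_inter]
      exact (hW.isClosed_compl.isLocallyClosed).inter U.isOpen.isLocallyClosed)
    apply hxW
    have := h x hx
    have h0 : X.presheaf.germ U x hxU s = 0 := (hs.map _).eq_zero
    rw [← map_zero (X.presheaf.germ U x hxU).hom] at h0
    obtain ⟨V, hxV, iU, iV, e⟩ := X.presheaf.germ_eq x hxU hxU s 0 h0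
    refine ⟨V, hxV, iU, ?_⟩
    exact e.trans (map_zero _)
  apply TopCat.Presheaf.section_ext X.sheaf U s 0
  intro x hx
  obtain ⟨V, hxV, i, hV⟩ := hUW hx
  change (X.presheaf.germ U x hx) s = (X.presheaf.germ U x hx) 0
  rw [map_zero, ← X.presheaf.germ_res i x hxV, CommRingCat.comp_apply, hV, map_zero]

variable {k : Type} [Field k]

/-- The unique point of `Spec k`. -/
abbrev pt0 (k : Type) [Field k] : (ptO k).left := (IsLocalRing.closedPoint k : PrimeSpectrum k)

lemma pt0_unique (k : Type) [Field k] (x : (ptO k).left) : x = pt0 k :=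
  Subsingleton.elim (α := PrimeSpectrum k) _ _

lemma exists_point [IsAlgClosed k] (X : OverR k) [LocallyOfFiniteType X.hom] (x : X.left) (hx : IsClosed {x}) :
    ∃ p : ptO k ⟶ X, p.left (pt0 k) = x :=
  ⟨Over.homMk (pointOfClosedPoint X.hom x hx) (pointOfClosedPoint_comp X.hom x hx),
    pointOfClosedPoint_apply X.hom x hx _⟩

lemma isClosed_point [IsAlgClosed k] (X : OverR k) [LocallyOfFiniteType X.hom] (p : ptO k ⟶ X) :
    IsClosed {p.left (pt0 k)} :=
  (pointEquivClosedPoint X.hom ⟨p.left, Over.w p⟩).2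

lemma point_ext [IsAlgClosed k] {X : OverR k} [LocallyOfFiniteType X.hom] {p q : ptO k ⟶ X}
    (h : p.left (pt0 k) = q.left (pt0 k)) : p = q := by
  ext1
  exact ext_of_apply_closedPoint_eq X.hom (Over.w p) (Over.w q) h

/-- The theorem of Cartier. -/
lemma GroupScheme.isReduced [IsAlgClosed k] [CharZero k] (Γ : GroupScheme k) [LocallyOfFiniteType Γ.G.hom] :
    IsReduced Γ.G.left := by
  have : JacobsonSpace Γ.G.left := LocallyOfFiniteType.jacobsonSpace Γ.G.hom
  have : IsLocallyNoetherian Γ.G.left := LocallyOfFiniteType.isLocallyNoetherian Γ.G.hom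
  refine isReduced_of_isReduced_stalk_closedPoint fun x hx => ?_
  obtain ⟨p, hp⟩ := exists_point Γ.G x hx
  refine cartier_local Γ (toPt _ ≫ p) x ?_
  rw [← hp]
  change p.left ((toPt (SpO k k)).left _) = _
  congr 1

/-- Left translation. -/
def GroupScheme.translate (Γ : GroupScheme k) (a : ptO k ⟶ Γ.G) : Γ.G ⟶ Γ.G :=
  (toPt _ ≫ a) * 𝟙 _

lemma GroupScheme.comp_translate (Γ : GroupScheme k) (a : ptO k ⟶ Γ.G) {T : OverR k}
    (f : T ⟶ Γ.G) : f ≫ Γ.translate a = (toPt T ≫ a) * f := by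
  rw [translate, Γ.comp_mul, Category.comp_id, ← Category.assoc, comp_toPt]


lemma GroupScheme.translate_comp (Γ : GroupScheme k) (a b : ptO k ⟶ Γ.G) :
    Γ.translate a ≫ Γ.translate b = Γ.translate (b * a) := by
  rw [comp_translate, translate, translate, ← _root_.mul_assoc, ← Γ.comp_mul]

lemma GroupScheme.translate_one (Γ : GroupScheme k) : Γ.translate 1 = 𝟙 _ := by
  rw [translate, Γ.comp_one, _root_.one_mul]

/-- Left translation as an isomorphism. -/
def GroupScheme.translateIso (Γ : GroupScheme k) (a : ptO k ⟶ Γ.G) : Γ.G.left ≅ Γ.G.left where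
  hom := (Γ.translate a).left
  inv := (Γ.translate a⁻¹).left
  hom_inv_id := by
    rw [← Over.comp_left, Γ.translate_comp, inv_mul_cancel, Γ.translate_one]; rfl
  inv_hom_id := by
    rw [← Over.comp_left, Γ.translate_comp, mul_inv_cancel, Γ.translate_one]; rfl

lemma GroupScheme.translateIso_apply (Γ : GroupScheme k) (p q : ptO k ⟶ Γ.G) :
    (Γ.translateIso (q * p⁻¹)).hom (p.left (pt0 k)) = q.left (pt0 k) := by
  have h : p ≫ Γ.translate (q * p⁻¹) = q := by
    rw [comp_translate]
    have : toPt (ptO k) = 𝟙 _ := rfl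
    rw [this, Category.id_comp, inv_mul_cancel_right]
  conv_rhs => rw [← h]
  rfl

/-- A connected space in which each point has an irreducible neighbourhood is irreducible. -/
lemma irreducibleSpace_of_connected_of_locally {X : Type} [TopologicalSpace X] [ConnectedSpace X]
    (h : ∀ x : X, ∃ U : Set X, IsOpen U ∧ x ∈ U ∧ IsPreirreducible U) : IrreducibleSpace X := by
  obtain ⟨x0⟩ : Nonempty X := inferInstance
  set Z := irreducibleComponent x0 with hZ
  have hZc : IsClosed Z := isClosed_irreducibleComponent
  have hZi : IsIrreducible Z := isIrreducible_irreducibleComponent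
  have hZo : IsOpen Z := by
    rw [isOpen_iff_forall_mem_open]
    intro x hx
    obtain ⟨U, hU, hxU, hUi⟩ := h x
    refine ⟨U, ?_, hU, hxU⟩
    have h1 : Z ⊆ closure U :=
      (subset_closure_inter_of_isPreirreducible_of_isOpen hZi.2 hU ⟨x, hx, hxU⟩).trans
        (closure_mono Set.inter_subset_right)
    have h2 : closure U = Z := eq_irreducibleComponent hUi.closure h1
    rw [← h2]; exact subset_closure
  have : Z = Set.univ := IsClopen.eq_univ ⟨hZc, hZo⟩ hZi.1
  rw [this] at hZi
  exact (irreducibleSpace_def X).2 hZi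

lemma GroupScheme.irreducibleSpace [IsAlgClosed k] (Γ : GroupScheme k)
    (hΓ : Γ.IsFiniteTypeConnected) : IrreducibleSpace Γ.G.left := by
  obtain ⟨_, _, _⟩ := hΓ
  have : JacobsonSpace Γ.G.left := LocallyOfFiniteType.jacobsonSpace Γ.G.hom
  have : IsLocallyNoetherian Γ.G.left := LocallyOfFiniteType.isLocallyNoetherian Γ.G.hom
  have : CompactSpace Γ.G.left := (quasiCompact_iff_compactSpace (Γ.G.hom)).1 inferInstance
  have : IsNoetherian Γ.G.left := {}
  let W : Set Γ.G.left := {x | ∃ U : Set Γ.G.left, IsOpen U ∧ x ∈ U ∧ IsPreirreducible U}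
  have hW : IsOpen W := by
    rw [isOpen_iff_forall_mem_open]
    rintro x ⟨U, hU, hx, hUi⟩
    exact ⟨U, fun y hy => ⟨U, hU, hy, hUi⟩, hU, hx⟩
  have hWn : W.Nonempty := by
    obtain ⟨x0⟩ : Nonempty Γ.G.left := inferInstance
    obtain ⟨o, ho, hne, hle⟩ :=
      TopologicalSpace.NoetherianSpace.exists_isOpen_nonempty_subset_irreducibleComponent
        (irreducibleComponent x0) (irreducibleComponent_mem_irreducibleComponents x0)
    obtain ⟨x, hx⟩ := hne
    exact ⟨x, o, ho, hx, isIrreducible_irreducibleComponent.2.open_subset ho hle⟩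
  have hWu : W = Set.univ := by
    rw [← Set.compl_empty_iff, ← Set.not_nonempty_iff_eq_empty]
    intro H
    obtain ⟨y, hyW, hy⟩ := nonempty_inter_closedPoints H hW.isClosed_compl.isLocallyClosed
    obtain ⟨x, ⟨U, hU, hxU, hUi⟩, hx⟩ := nonempty_inter_closedPoints hWn hW.isLocallyClosed
    obtain ⟨p, rfl⟩ := exists_point Γ.G x hx
    obtain ⟨q, rfl⟩ := exists_point Γ.G y hy
    apply hyW
    let e := Γ.translateIso (q * p⁻¹)
    refine ⟨e.hom '' U, e.hom.homeomorph.isOpenMap _ hU,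
      ⟨_, hxU, Γ.translateIso_apply p q⟩, hUi.image _ e.hom.continuous.continuousOn⟩
  exact irreducibleSpace_of_connected_of_locally fun x => by
    have : x ∈ W := hWu ▸ trivial
    exact this

end

section
/-! ### Products -/

section
variable {k : Type} [CommRing k]

/-- The fibre product over the base. -/
def prodO (X Y : OverR k) : OverR k := Over.mk (pullback.fst X.hom Y.hom ≫ X.hom)

/-- First projection. -/
def prodO.p1 (X Y : OverR k) : prodO X Y ⟶ X := Over.homMk (pullback.fst X.hom Y.hom) rfl

/-- Second projection. -/
def prodO.p2 (X Y : OverR k) : prodO X Y ⟶ Y :=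
  Over.homMk (pullback.snd X.hom Y.hom) pullback.condition.symm

/-- Pairing. -/
def prodO.pair {T X Y : OverR k} (f : T ⟶ X) (g : T ⟶ Y) : T ⟶ prodO X Y :=
  Over.homMk (pullback.lift f.left g.left ((Over.w f).trans (Over.w g).symm))
    ((Category.assoc _ _ _).symm.trans
      ((congrArg (· ≫ X.hom) (pullback.lift_fst _ _ _)).trans (Over.w f)))

@[simp] lemma prodO.pair_p1 {T X Y : OverR k} (f : T ⟶ X) (g : T ⟶ Y) :
    prodO.pair f g ≫ prodO.p1 X Y = f := by
  ext1; exact pullback.lift_fst _ _ _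

@[simp] lemma prodO.pair_p2 {T X Y : OverR k} (f : T ⟶ X) (g : T ⟶ Y) :
    prodO.pair f g ≫ prodO.p2 X Y = g := by
  ext1; exact pullback.lift_snd _ _ _

lemma prodO.hom_ext {T X Y : OverR k} {f g : T ⟶ prodO X Y}
    (h1 : f ≫ prodO.p1 X Y = g ≫ prodO.p1 X Y)
    (h2 : f ≫ prodO.p2 X Y = g ≫ prodO.p2 X Y) : f = g := by
  ext1
  exact pullback.hom_ext (congrArg (fun q => q.left) h1) (congrArg (fun q => q.left) h2)

lemma prodO.comp_pair {T' T X Y : OverR k} (h : T' ⟶ T) (f : T ⟶ X) (g : T ⟶ Y) :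
    h ≫ prodO.pair f g = prodO.pair (h ≫ f) (h ≫ g) := by
  apply prodO.hom_ext
  · rw [Category.assoc, pair_p1, pair_p1]
  · rw [Category.assoc, pair_p2, pair_p2]

/-- Products of morphisms. -/
def prodO.map {X Y X' Y' : OverR k} (f : X ⟶ X') (g : Y ⟶ Y') : prodO X Y ⟶ prodO X' Y' :=
  prodO.pair (prodO.p1 X Y ≫ f) (prodO.p2 X Y ≫ g)

/-- Products of group schemes. -/
def GroupScheme.prod (Γ Δ : GroupScheme k) : GroupScheme k where
  G := prodO Γ.G Δ.G
  mul a b := prodO.pair ((a ≫ prodO.p1 _ _) * (b ≫ prodO.p1 _ _))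
    ((a ≫ prodO.p2 _ _) * (b ≫ prodO.p2 _ _))
  one T := prodO.pair 1 1
  inv a := prodO.pair (a ≫ prodO.p1 _ _)⁻¹ (a ≫ prodO.p2 _ _)⁻¹
  mul_assoc a b c := by simp only [prodO.pair_p1, prodO.pair_p2, _root_.mul_assoc]
  one_mul a := by
    apply prodO.hom_ext <;> simp only [prodO.pair_p1, prodO.pair_p2, _root_.one_mul]
  inv_mul a := by simp only [prodO.pair_p1, prodO.pair_p2, inv_mul_cancel]
  mul_natural f a b := by
    simp only [prodO.comp_pair, Γ.comp_mul, Δ.comp_mul, Category.assoc]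
  one_natural f := by simp only [prodO.comp_pair, Γ.comp_one, Δ.comp_one]

instance prodO.instLft (X Y : OverR k) [LocallyOfFiniteType X.hom] [LocallyOfFiniteType Y.hom] :
    LocallyOfFiniteType (prodO X Y).hom :=
  inferInstanceAs (LocallyOfFiniteType (pullback.fst X.hom Y.hom ≫ X.hom))

instance prodO.instProper (X Y : OverR k) [IsProper X.hom] [IsProper Y.hom] :
    IsProper (prodO X Y).hom :=
  inferInstanceAs (IsProper (pullback.fst X.hom Y.hom ≫ X.hom))

instance prodO.instProper1 (X Y : OverR k) [IsProper Y.hom] :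
    IsProper (prodO.p1 X Y).left :=
  inferInstanceAs (IsProper (pullback.fst X.hom Y.hom))

instance prodO.instSurj1 (X Y : OverR k) [Surjective Y.hom] :
    Surjective (prodO.p1 X Y).left :=
  inferInstanceAs (Surjective (pullback.fst X.hom Y.hom))
end

instance OverR.universallyOpen {k : Type} [Field k] (X : OverR k) : UniversallyOpen X.hom := by
  infer_instance

instance prodO.instOpen1 {k : Type} [Field k] (X Y : OverR k) :
    UniversallyOpen (prodO.p1 X Y).left :=
  inferInstanceAs (UniversallyOpen (pullback.fst X.hom Y.hom))

lemma OverR.surjective_hom {k : Type} [Field k] (X : OverR k) [Nonempty X.left] :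
    Surjective X.hom := by
  refine ⟨fun y => ?_⟩
  obtain ⟨x⟩ : Nonempty X.left := inferInstance
  exact ⟨x, Subsingleton.elim (α := PrimeSpectrum k) _ _⟩

end

section
/-! ### Rigidity -/

section
variable {k : Type} [Field k]

/-- The inclusion of a fibre `{x} × Y`. -/
def prodO.slice {X : OverR k} (Y : OverR k) (x : ptO k ⟶ X) : Y ⟶ prodO X Y :=
  prodO.pair (toPt Y ≫ x) (𝟙 Y)

lemma prodO.slice_apply_p1 {X : OverR k} (Y : OverR k) (x : ptO k ⟶ X) (y : Y.left) :
    (prodO.p1 X Y).left ((prodO.slice Y x).left y) = x.left (pt0 k) := by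
  have h : prodO.slice Y x ≫ prodO.p1 X Y = toPt Y ≫ x := prodO.pair_p1 _ _
  have h2 := congrArg (fun q => q.left y) h
  refine Eq.trans h2 ?_
  exact congrArg (fun z => x.left z) (pt0_unique k _)

lemma prodO.range_slice [IsAlgClosed k] {X : OverR k} (Y : OverR k)
    [LocallyOfFiniteType X.hom] [LocallyOfFiniteType Y.hom] [IsSeparated X.hom]
    (x : ptO k ⟶ X) :
    (prodO.p1 X Y).left ⁻¹' {x.left (pt0 k)} = Set.range (prodO.slice Y x).left := by
  have : JacobsonSpace (prodO X Y).left := LocallyOfFiniteType.jacobsonSpace (prodO X Y).hom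
  have hsep : IsSeparated (prodO.p2 X Y).left :=
    inferInstanceAs (IsSeparated (pullback.snd X.hom Y.hom))
  have hid : (prodO.slice Y x).left ≫ (prodO.p2 X Y).left = 𝟙 Y.left :=
    congrArg (fun q => q.left) (prodO.pair_p2 (toPt Y ≫ x) (𝟙 Y))
  have : IsClosedImmersion ((prodO.slice Y x).left ≫ (prodO.p2 X Y).left) := by
    rw [hid]; infer_instance
  have hcl : IsClosedImmersion (prodO.slice Y x).left := .of_comp _ (prodO.p2 X Y).left
  apply subset_antisymm
  · rw [← Set.sdiff_eq_empty, ← Set.not_nonempty_iff_eq_empty]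
    intro H
    obtain ⟨c₀, ⟨hc₁, hc₂⟩, hc₃⟩ := nonempty_inter_closedPoints H <| by
      rw [Set.sdiff_eq_compl_inter]
      refine (IsOpen.isLocallyClosed ?_).inter (IsClosed.isLocallyClosed ?_)
      · exact ((prodO.slice Y x).left.isClosedMap.isClosed_range).isOpen_compl
      · exact (isClosed_point X x).preimage (prodO.p1 X Y).left.continuous
    obtain ⟨c, rfl⟩ := exists_point _ c₀ hc₃
    have h1 : c ≫ prodO.p1 X Y = x := point_ext hc₁
    have h2 : c = (c ≫ prodO.p2 X Y) ≫ prodO.slice Y x := by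
      apply prodO.hom_ext
      · rw [h1, prodO.slice, Category.assoc, prodO.pair_p1, ← Category.assoc, comp_toPt]
        exact (Category.id_comp _).symm
      · rw [prodO.slice, Category.assoc, Category.assoc, prodO.pair_p2, Category.comp_id]
    exact hc₂ ⟨(c ≫ prodO.p2 X Y).left (pt0 k), (congrArg (fun q => q.left (pt0 k)) h2).symm⟩
  · rintro _ ⟨y, rfl⟩
    exact prodO.slice_apply_p1 Y x y

lemma finite_fibre_inter_range {X Y S : Scheme.{0}} (f : X ⟶ Y) (g : Y ⟶ S) [IsProper f]
    (U : S.Opens) (H : IsFinite ((f.imageι ≫ g) ∣_ U)) (x : S) (hx : x ∈ U) :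
    (g ⁻¹' {x} ∩ Set.range f).Finite := by
  have hfin := ((f.imageι ≫ g) ∣_ U).finite_preimage_singleton (⟨x, hx⟩ : U)
  refine (hfin.image (fun w => f.imageι (((f.imageι ≫ g) ⁻¹ᵁ U).ι w))).subset ?_
  rintro _ ⟨h1, w, rfl⟩
  have hfw : f w = f.imageι (f.toImage w) := by
    rw [← Scheme.Hom.comp_apply, Scheme.Hom.toImage_imageι]
  have hmem : f.toImage w ∈ (f.imageι ≫ g) ⁻¹ᵁ U := by
    change (f.imageι ≫ g) (f.toImage w) ∈ U
    rw [Scheme.Hom.comp_apply, ← hfw]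
    exact (h1 : g (f w) = x) ▸ hx
  refine ⟨(⟨f.toImage w, hmem⟩ : ((f.imageι ≫ g) ⁻¹ᵁ U)), ?_, ?_⟩
  · have := congrArg (fun q => q (⟨f.toImage w, hmem⟩ : ((f.imageι ≫ g) ⁻¹ᵁ U)))
      (morphismRestrict_ι (f.imageι ≫ g) U)
    apply Subtype.ext
    refine this.trans ?_
    change (f.imageι ≫ g) (f.toImage w) = x
    rw [Scheme.Hom.comp_apply, ← hfw]
    exact h1
  · exact hfw.symm

theorem rigidity [IsAlgClosed k] (X Y Z : OverR k) [IsProper X.hom] [IsProper Y.hom]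
    [IsProper Z.hom] [IrreducibleSpace X.left] [IrreducibleSpace Y.left]
    [IsReduced (prodO X Y).left]
    (F : prodO X Y ⟶ Z) (x₀ : ptO k ⟶ X) (y₀ : ptO k ⟶ Y) (z₀ : ptO k ⟶ Z)
    (hF : prodO.slice Y x₀ ≫ F = toPt Y ≫ z₀) :
    F = prodO.p1 X Y ≫ prodO.pair (𝟙 X) (toPt X ≫ y₀) ≫ F := by
  have : Surjective Y.hom := OverR.surjective_hom Y
  have : JacobsonSpace (prodO X Y).left := LocallyOfFiniteType.jacobsonSpace (prodO X Y).hom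
  let γ : prodO X Y ⟶ prodO X Z := prodO.pair (prodO.p1 X Y) F
  have hγ1 : γ ≫ prodO.p1 X Z = prodO.p1 X Y := prodO.pair_p1 _ _
  have hγ2 : γ ≫ prodO.p2 X Z = F := prodO.pair_p2 _ _
  have hγ1' : γ.left ≫ (prodO.p1 X Z).left = (prodO.p1 X Y).left :=
    congrArg (fun q => q.left) hγ1
  have : IsProper (γ.left ≫ (prodO.p1 X Z).left) := by rw [hγ1']; infer_instance
  have : IsProper γ.left := .of_comp _ (prodO.p1 X Z).left
  have H : γ.left '' ((prodO.p1 X Y).left ⁻¹' {x₀.left (pt0 k)}) ⊆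
      {(prodO.pair x₀ z₀).left (pt0 k)} := by
    rw [prodO.range_slice]
    rintro _ ⟨_, ⟨y, rfl⟩, rfl⟩
    have h1 : prodO.slice Y x₀ ≫ γ = toPt Y ≫ prodO.pair x₀ z₀ := by
      rw [prodO.comp_pair, prodO.comp_pair, hF, prodO.slice, prodO.pair_p1]
    refine (congrArg (fun q => q.left y) h1).trans ?_
    exact congrArg (fun z => (prodO.pair x₀ z₀).left z) (pt0_unique k _)
  obtain ⟨U, hηU, H⟩ := exists_finite_imageι_comp_morphismRestrict_of_finite_image_preimage
    γ.left (prodO.p1 X Z).left (x₀.left (pt0 k)) (by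
      rw [hγ1']
      exact (Set.finite_singleton _).subset H)
  have H (x : U) : ((prodO.p1 X Z).left ⁻¹' {x.1} ∩ Set.range ⇑γ.left).Finite :=
    finite_fibre_inter_range _ _ U H x.1 x.2
  ext1
  have hUd : Dense ((U : Set X.left)) := U.isOpen.dense ⟨_, hηU⟩
  have : LocallyOfFiniteType (F.left ≫ Z.hom) := by rw [Over.w F]; infer_instance
  refine ext_of_apply_eq Z.hom ((prodO.p1 X Y).left ⁻¹' (U : Set X.left))
    ((prodO.p1 X Y).left ⁻¹ᵁ U).isOpen.isLocallyClosed ?_ ?_ ?_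
  · exact hUd.preimage (prodO.p1 X Y).left.isOpenMap
  · intro y hyU hy
    have hx : IsClosed {(prodO.p1 X Y).left y} := by
      simpa using (prodO.p1 X Y).left.isClosedMap _ hy
    obtain ⟨x, hx'⟩ := exists_point X _ hx
    let ε : X ⟶ prodO X Y := prodO.pair (𝟙 X) (toPt X ≫ y₀)
    have hε : ε ≫ prodO.p1 X Y = 𝟙 X := prodO.pair_p1 _ _
    let xe : (prodO X Y).left := ε.left ((prodO.p1 X Y).left y)
    have hxe : (prodO.p1 X Y).left xe = (prodO.p1 X Y).left y :=
      congrArg (fun q => q.left ((prodO.p1 X Y).left y)) hε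
    have : γ.left y = γ.left xe := by
      refine subsingleton_image_closure_of_finite_of_isPreirreducible
        (S := (prodO.p1 X Y).left ⁻¹' {(prodO.p1 X Y).left y})
        (hx.preimage (prodO.p1 X Y).left.continuous).isLocallyClosed ?_ γ.left.continuous
        γ.left.isClosedMap ((H ⟨_, hyU⟩).subset (Set.image_subset_iff.mpr fun w hw ↦ ?_)) ?_ ?_
      · rw [← hx', prodO.range_slice, ← Set.image_univ]
        exact ((IrreducibleSpace.isIrreducible_univ _).image (prodO.slice Y x).left
              (prodO.slice Y x).left.continuous.continuousOn).isPreirreducible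
      · refine ⟨?_, w, rfl⟩
        have h5 : (prodO.p1 X Z).left (γ.left w) = (prodO.p1 X Y).left w :=
          congrArg (fun q => q.left w) hγ1
        exact h5.trans hw
      · exact ⟨y, subset_closure rfl, rfl⟩
      · exact ⟨xe, subset_closure hxe, rfl⟩
    have h3 := congrArg (fun w => (prodO.p2 X Z).left w) this
    have hF1 : (prodO.p2 X Z).left (γ.left y) = F.left y := congrArg (fun q => q.left y) hγ2
    have hF2 : (prodO.p2 X Z).left (γ.left xe) = F.left xe := congrArg (fun q => q.left xe) hγ2
    exact hF1.symm.trans (h3.trans hF2)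
  · exact (Over.w F).trans (Over.w _).symm
end
end

section
section
variable {k : Type} [Field k]

lemma GroupScheme.prodO_isReduced [IsAlgClosed k] [CharZero k] (Γ : GroupScheme k)
    [LocallyOfFiniteType Γ.G.hom] : IsReduced (prodO Γ.G Γ.G).left := by
  have : LocallyOfFiniteType (Γ.prod Γ).G.hom :=
    inferInstanceAs (LocallyOfFiniteType (prodO Γ.G Γ.G).hom)
  exact (Γ.prod Γ).isReduced

theorem GroupScheme.map_mul_of_map_one [IsAlgClosed k] [CharZero k] (Γ A : GroupScheme k)
    (hΓ : Γ.IsAbelianVariety) (hA : IsProper A.G.hom) (g : Γ.G ⟶ A.G)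
    (hg : (1 : ptO k ⟶ Γ.G) ≫ g = 1) {T : OverR k} (a b : T ⟶ Γ.G) :
    (a * b) ≫ g = (a ≫ g) * (b ≫ g) := by
  obtain ⟨hc, hp⟩ := hΓ
  have := Γ.irreducibleSpace hc
  have := Γ.prodO_isReduced
  have hone (S : OverR k) : (1 : S ⟶ Γ.G) ≫ g = 1 := by
    rw [← Γ.comp_one (toPt S), Category.assoc, hg, A.comp_one]
  let p := prodO.p1 Γ.G Γ.G
  let q := prodO.p2 Γ.G Γ.G
  let F : prodO Γ.G Γ.G ⟶ A.G := ((p * q) ≫ g) * (q ≫ g)⁻¹ * (p ≫ g)⁻¹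
  have hF {S : OverR k} (a b : S ⟶ Γ.G) : prodO.pair a b ≫ F =
      ((a * b) ≫ g) * (b ≫ g)⁻¹ * (a ≫ g)⁻¹ := by
    simp only [F, p, q, A.comp_mul, A.comp_inv, ← Category.assoc, Γ.comp_mul, prodO.pair_p1,
      prodO.pair_p2]
  have h1 : F = 1 := by
    have := rigidity Γ.G Γ.G A.G F 1 1 1 (by
      rw [prodO.slice, hF, Γ.comp_one, A.comp_one, _root_.one_mul, hone, Category.id_comp,
        mul_inv_cancel, _root_.one_mul, inv_one])
    rw [this, hF, Γ.comp_one, _root_.mul_one, hone, Category.id_comp, inv_one, _root_.mul_one,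
      mul_inv_cancel, A.comp_one]
  have h2 := hF a b
  rw [h1, A.comp_one] at h2
  have h3 := (eq_mul_inv_iff_mul_eq.1 (h2.trans rfl))
  have h4 := (eq_mul_inv_iff_mul_eq.1 h3)
  rw [_root_.one_mul] at h4
  exact h4.symm

lemma exists_lift_of_dominant {V W B A : OverR k} (u : V ⟶ W) (q : W ⟶ A) (w : V ⟶ B) (j : B ⟶ A)
    [IsSchemeTheoreticallyDominant u.left] [IsClosedImmersion j.left] (h : u ≫ q = w ≫ j) :
    ∃ m : W ⟶ B, m ≫ j = q := by
  have hker : j.left.ker ≤ q.left.ker := by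
    have h' : u.left ≫ q.left = w.left ≫ j.left := congrArg (fun z => z.left) h
    have h1 : (u.left ≫ q.left).ker = q.left.ker := by
      rw [Scheme.Hom.ker_comp, u.left.ker_eq_bot, Scheme.IdealSheafData.map_bot]
    rw [← h1, h']
    exact Scheme.Hom.le_ker_comp _ _
  refine ⟨Over.homMk (IsClosedImmersion.lift j.left q.left hker) ?_, ?_⟩
  · rw [← Over.w j, ← Category.assoc, IsClosedImmersion.lift_fac, Over.w q]
  · ext1
    exact IsClosedImmersion.lift_fac _ _ _

lemma prodO.dominant_map_id (X : OverR k) {Y Y' : OverR k} (g : Y ⟶ Y')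
    [IsSchemeTheoreticallyDominant g.left] [QuasiCompact g.left] :
    IsSchemeTheoreticallyDominant (prodO.map (𝟙 X) g).left := by
  have hb : IsPullback (prodO.p1 X Y').left (prodO.p2 X Y').left X.hom Y'.hom :=
    IsPullback.of_hasPullback X.hom Y'.hom
  have ha : IsPullback (prodO.p1 X Y).left (prodO.p2 X Y).left X.hom Y.hom :=
    IsPullback.of_hasPullback X.hom Y.hom
  have e1 : (prodO.map (𝟙 X) g).left ≫ (prodO.p1 X Y').left = (prodO.p1 X Y).left :=
    congrArg (fun z => z.left)
      ((prodO.pair_p1 (prodO.p1 X Y ≫ 𝟙 X) (prodO.p2 X Y ≫ g)).trans (Category.comp_id _))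
  have e2 : (prodO.map (𝟙 X) g).left ≫ (prodO.p2 X Y').left = (prodO.p2 X Y).left ≫ g.left :=
    congrArg (fun z => z.left) (prodO.pair_p2 (prodO.p1 X Y ≫ 𝟙 X) (prodO.p2 X Y ≫ g))
  have hbig : IsPullback ((prodO.map (𝟙 X) g).left ≫ (prodO.p1 X Y').left) (prodO.p2 X Y).left
      X.hom (g.left ≫ Y'.hom) := by
    rw [e1, Over.w g]; exact ha
  have hsm := IsPullback.of_right hbig.flip.flip e2 hb
  have : Flat (prodO.p2 X Y').left := inferInstanceAs (Flat (pullback.snd X.hom Y'.hom))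
  exact IsSchemeTheoreticallyDominant.of_isPullback hsm.flip

lemma prodO.dominant_id_map {X X' : OverR k} (Y : OverR k) (g : X ⟶ X')
    [IsSchemeTheoreticallyDominant g.left] [QuasiCompact g.left] :
    IsSchemeTheoreticallyDominant (prodO.map g (𝟙 Y)).left := by
  have hb : IsPullback (prodO.p1 X' Y).left (prodO.p2 X' Y).left X'.hom Y.hom :=
    IsPullback.of_hasPullback X'.hom Y.hom
  have ha : IsPullback (prodO.p1 X Y).left (prodO.p2 X Y).left X.hom Y.hom :=
    IsPullback.of_hasPullback X.hom Y.hom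
  have e1 : (prodO.map g (𝟙 Y)).left ≫ (prodO.p2 X' Y).left = (prodO.p2 X Y).left :=
    congrArg (fun z => z.left)
      ((prodO.pair_p2 (prodO.p1 X Y ≫ g) (prodO.p2 X Y ≫ 𝟙 Y)).trans (Category.comp_id _))
  have e2 : (prodO.map g (𝟙 Y)).left ≫ (prodO.p1 X' Y).left = (prodO.p1 X Y).left ≫ g.left :=
    congrArg (fun z => z.left) (prodO.pair_p1 (prodO.p1 X Y ≫ g) (prodO.p2 X Y ≫ 𝟙 Y))
  have hbig : IsPullback ((prodO.map g (𝟙 Y)).left ≫ (prodO.p2 X' Y).left) (prodO.p1 X Y).left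
      Y.hom (g.left ≫ X'.hom) := by
    rw [e1, Over.w g]; exact ha.flip
  have hsm := IsPullback.of_right hbig e2 hb.flip
  have : Flat (prodO.p1 X' Y).left := inferInstanceAs (Flat (pullback.fst X'.hom Y.hom))
  exact IsSchemeTheoreticallyDominant.of_isPullback hsm.flip

lemma prodO.dominant_map {X X' : OverR k} (g : X ⟶ X')
    [IsSchemeTheoreticallyDominant g.left] [QuasiCompact g.left] :
    IsSchemeTheoreticallyDominant (prodO.map g g).left := by
  have h : prodO.map g g = prodO.map g (𝟙 X) ≫ prodO.map (𝟙 X') g := by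
    apply prodO.hom_ext
    · simp only [prodO.map, prodO.pair_p1, Category.assoc, Category.comp_id]
    · simp only [prodO.map, prodO.pair_p2, Category.assoc]
      rw [← Category.assoc (prodO.pair _ _), prodO.pair_p2, Category.assoc, Category.id_comp]
  have h1 := prodO.dominant_id_map X g
  have h2 := prodO.dominant_map_id X' g
  rw [h]
  exact inferInstanceAs (IsSchemeTheoreticallyDominant
    ((prodO.map g (𝟙 X)).left ≫ (prodO.map (𝟙 X') g).left))

lemma dominant_toImage {X Y : Scheme.{0}} (f : X ⟶ Y) [QuasiCompact f] :
    IsSchemeTheoreticallyDominant f.toImage := by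
  constructor
  refine Scheme.IdealSheafData.ext_of_iSup_eq_top
    (fun U : Y.affineOpens => (⟨f.imageι ⁻¹ᵁ U.1, U.2.preimage f.imageι⟩ : f.image.affineOpens))
    ?_ fun U => ?_
  · refine top_le_iff.1 ?_
    intro x _
    have hx : f.imageι x ∈ (⨆ i : Y.affineOpens, (i : Y.Opens)) := by
      rw [iSup_affineOpens_eq_top Y]; trivial
    obtain ⟨U, hU⟩ := TopologicalSpace.Opens.mem_iSup.1 hx
    exact TopologicalSpace.Opens.mem_iSup.2 ⟨U, hU⟩
  · rw [Scheme.Hom.ker_apply]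
    exact (RingHom.injective_iff_ker_eq_bot _).1 (f.toImage_app_injective U)

/-- The image of a homomorphism from an abelian variety. -/
theorem GroupScheme.exists_image (Γ A : GroupScheme k)
    (hΓ : Γ.IsAbelianVariety) (hA : IsProper A.G.hom) (g : Γ.G ⟶ A.G)
    (hg : ∀ {T : OverR k} (a b : T ⟶ Γ.G), (a * b) ≫ g = (a ≫ g) * (b ≫ g)) :
    ∃ (B : GroupScheme k) (j : B.G ⟶ A.G) (π : Γ.G ⟶ B.G), B.IsAbelianVariety ∧
      IsClosedImmersion j.left ∧
      (∀ {T : OverR k} (a b : T ⟶ B.G), B.mul a b ≫ j = A.mul (a ≫ j) (b ≫ j)) ∧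
      π ≫ j = g ∧ IsSchemeTheoreticallyDominant π.left := by
  obtain ⟨⟨hft, hqc, hconn⟩, hp⟩ := hΓ
  have hgone (T : OverR k) : (1 : T ⟶ Γ.G) ≫ g = 1 := by
    have := hg (1 : T ⟶ Γ.G) 1
    rw [_root_.mul_one] at this
    exact (mul_eq_left.1 this.symm)
  have hginv {T : OverR k} (a : T ⟶ Γ.G) : a⁻¹ ≫ g = (a ≫ g)⁻¹ := by
    rw [eq_inv_iff_mul_eq_one, ← hg, inv_mul_cancel, hgone]
  have : IsProper (g.left ≫ A.G.hom) := by rw [Over.w g]; infer_instance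
  have hpg : IsProper g.left := .of_comp _ A.G.hom
  let BB : OverR k := Over.mk (g.left.imageι ≫ A.G.hom)
  let j : BB ⟶ A.G := Over.homMk g.left.imageι rfl
  let π : Γ.G ⟶ BB := Over.homMk g.left.toImage
    ((Category.assoc _ _ _).symm.trans
      ((congrArg (· ≫ A.G.hom) g.left.toImage_imageι).trans (Over.w g)))
  have hπj : π ≫ j = g := by ext1; exact g.left.toImage_imageι
  have hj : IsClosedImmersion j.left := inferInstanceAs (IsClosedImmersion g.left.imageι)
  have hπq : QuasiCompact π.left := inferInstanceAs (QuasiCompact g.left.toImage)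
  have hπd : IsSchemeTheoreticallyDominant π.left := dominant_toImage g.left
  have hjm : Mono j := by
    have : Mono ((Over.forget _).map j) := inferInstanceAs (Mono j.left)
    exact (Over.forget _).mono_of_mono_map this
  have hππ := prodO.dominant_map π
  obtain ⟨m, hm⟩ := exists_lift_of_dominant (prodO.map π π)
    ((prodO.p1 BB BB ≫ j) * (prodO.p2 BB BB ≫ j))
    ((prodO.p1 Γ.G Γ.G * prodO.p2 Γ.G Γ.G) ≫ π) j (by
      rw [Category.assoc, hπj, hg, A.comp_mul, ← Category.assoc, ← Category.assoc, prodO.map,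
        prodO.pair_p1, prodO.pair_p2, Category.assoc, Category.assoc, hπj])
  obtain ⟨i, hi⟩ := exists_lift_of_dominant π (j⁻¹) ((𝟙 Γ.G)⁻¹ ≫ π) j (by
      rw [Category.assoc, hπj, hginv, A.comp_inv, hπj, Category.id_comp])
  have hmul {T : OverR k} (a b : T ⟶ BB) : (prodO.pair a b ≫ m) ≫ j = (a ≫ j) * (b ≫ j) := by
    rw [Category.assoc, hm, A.comp_mul, ← Category.assoc, ← Category.assoc, prodO.pair_p1,
      prodO.pair_p2]
  have hinv {T : OverR k} (a : T ⟶ BB) : (a ≫ i) ≫ j = (a ≫ j)⁻¹ := by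
    rw [Category.assoc, hi, A.comp_inv]
  have hone (T : OverR k) : ((1 : T ⟶ Γ.G) ≫ π) ≫ j = 1 := by
    rw [Category.assoc, hπj, hgone]
  let B : GroupScheme k :=
    { G := BB
      mul := fun a b => prodO.pair a b ≫ m
      one := fun T => (1 : T ⟶ Γ.G) ≫ π
      inv := fun a => a ≫ i
      mul_assoc := fun a b c => by
        rw [← cancel_mono j, hmul, hmul, hmul, hmul, _root_.mul_assoc]
      one_mul := fun a => by
        rw [← cancel_mono j, hmul, hone, _root_.one_mul]
      inv_mul := fun a => by
        rw [← cancel_mono j, hmul, hinv, hone, inv_mul_cancel]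
      mul_natural := fun f a b => by
        rw [← cancel_mono j, hmul, Category.assoc, hmul, A.comp_mul, Category.assoc,
          Category.assoc]
      one_natural := fun f => by
        rw [← Category.assoc, Γ.comp_one] }
  have hBp : IsProper BB.hom := inferInstanceAs (IsProper (g.left.imageι ≫ A.G.hom))
  have hsurj : Function.Surjective π.left := by
    have h1 : DenseRange π.left := π.left.denseRange
    have h2 : IsClosedMap π.left := g.left.toImage.isClosedMap
    exact Set.range_eq_univ.1 (h2.isClosed_range.closure_eq.symm.trans h1.closure_range)
  refine ⟨B, j, π, ⟨⟨?_, ?_, ?_⟩, hBp⟩, hj, fun a b => hmul a b, hπj, hπd⟩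
  · exact inferInstanceAs (LocallyOfFiniteType BB.hom)
  · exact inferInstanceAs (QuasiCompact BB.hom)
  · exact hsurj.connectedSpace π.left.continuous
end
end

section
/-! ### Algebra for morphisms from the multiplicative group -/

section
variable (k : Type) [Field k]

variable {k} in
/-- The algebra map from Laurent polynomials determined by a unit. -/
def lauHom {S : Type} [CommRing S] [Algebra k S] (x : Sˣ) : LaurentPolynomial k →ₐ[k] S :=
  { LaurentPolynomial.eval₂ (algebraMap k S) x with
    commutes' := fun r => by
      change LaurentPolynomial.eval₂ (algebraMap k S) x (algebraMap k _ r) = _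
      rw [← LaurentPolynomial.C_eq_algebraMap, LaurentPolynomial.eval₂_C] }

variable {k} in
lemma lauHom_T {S : Type} [CommRing S] [Algebra k S] (x : Sˣ) (n : ℤ) :
    lauHom (k := k) x (LaurentPolynomial.T n) = ((x ^ n : Sˣ) : S) :=
  LaurentPolynomial.eval₂_T _ _ _

variable {k} in
lemma lauHom_ext {S : Type} [CommRing S] [Algebra k S] {f g : LaurentPolynomial k →ₐ[k] S}
    (h : f (LaurentPolynomial.T 1) = g (LaurentPolynomial.T 1)) : f = g := by
  have h1 : ∀ n : ℕ, f (LaurentPolynomial.T n) = g (LaurentPolynomial.T n) := by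
    intro n
    have := LaurentPolynomial.T_pow (R := k) 1 n
    rw [mul_one] at this
    rw [← this, map_pow, map_pow, h]
  have h2 : ∀ n : ℕ, f (LaurentPolynomial.T (-n)) = g (LaurentPolynomial.T (-n)) := by
    intro n
    have hu : f (LaurentPolynomial.T n) * f (LaurentPolynomial.T (-n)) = 1 := by
      rw [← map_mul, ← LaurentPolynomial.T_add, add_neg_cancel, LaurentPolynomial.T_zero, map_one]
    have hv : g (LaurentPolynomial.T n) * g (LaurentPolynomial.T (-n)) = 1 := by
      rw [← map_mul, ← LaurentPolynomial.T_add, add_neg_cancel, LaurentPolynomial.T_zero, map_one]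
    rw [h1] at hu
    calc f (LaurentPolynomial.T (-n)) = (g (LaurentPolynomial.T n) * g (LaurentPolynomial.T (-n)))
            * f (LaurentPolynomial.T (-n)) := by rw [hv, one_mul]
      _ = g (LaurentPolynomial.T (-n)) * (g (LaurentPolynomial.T n) *
            f (LaurentPolynomial.T (-n))) := by ring
      _ = _ := by rw [hu, mul_one]
  refine AlgHom.ext fun p => ?_
  induction p using LaurentPolynomial.induction_on' with
  | add p q hp hq => rw [map_add, map_add, hp, hq]
  | C_mul_T n a =>
    rw [map_mul, map_mul, LaurentPolynomial.C_eq_algebraMap, f.commutes, g.commutes]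
    congr 1
    obtain ⟨m, rfl | rfl⟩ := n.eq_nat_or_neg
    · exact h1 m
    · exact h2 m

/-- Laurent series, with the standard algebra structures. -/
def LK : Type := LaurentSeries k

instance : Field (LK k) := inferInstanceAs (Field (LaurentSeries k))
instance : Algebra (PowerSeries k) (LK k) :=
  inferInstanceAs (Algebra (PowerSeries k) (LaurentSeries k))
instance : IsFractionRing (PowerSeries k) (LK k) :=
  inferInstanceAs (IsFractionRing (PowerSeries k) (LaurentSeries k))
instance : IsLocalization (Submonoid.powers (PowerSeries.X : PowerSeries k)) (LK k) :=
  inferInstanceAs (IsLocalization (Submonoid.powers (PowerSeries.X : PowerSeries k))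
    (LaurentSeries k))
instance : Algebra k (LK k) :=
  ((algebraMap (PowerSeries k) (LK k)).comp (algebraMap k (PowerSeries k))).toAlgebra

/-- The inclusion of power series in Laurent series. -/
def pslau : PowerSeries k →ₐ[k] LK k :=
  { algebraMap (PowerSeries k) (LK k) with
    commutes' := fun _ => rfl }

variable {k} in
/-- Coefficients. -/
def LK.coeff (n : ℤ) : LK k →+ k where
  toFun f := HahnSeries.coeff (show LaurentSeries k from f) n
  map_zero' := rfl
  map_add' _ _ := rfl

variable {k} in
lemma LK.ext {f g : LK k} (h : ∀ n, LK.coeff n f = LK.coeff n g) : f = g :=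
  HahnSeries.ext (funext h)

variable {k} in
lemma LK.algebraMap_mul (a : k) (f : LK k) : algebraMap k (LK k) a * f =
    (HahnSeries.C a * (show LaurentSeries k from f) : LaurentSeries k) := by
  have : (HahnSeries.C a : LaurentSeries k) =
      HahnSeries.ofPowerSeries ℤ k (algebraMap k (PowerSeries k) a) := by
    rw [PowerSeries.algebraMap_apply, HahnSeries.ofPowerSeries_C]; rfl
  rw [this]
  rfl

lemma pslau_coeff_neg (f : PowerSeries k) (n : ℤ) (hn : n < 0) :
    LK.coeff n (pslau k f) = 0 := by
  have := PowerSeries.coeff_coe f n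
  rw [if_pos hn] at this
  exact this

lemma pslau_coeff_zero (f : PowerSeries k) :
    LK.coeff 0 (pslau k f) = PowerSeries.constantCoeff f := by
  have := PowerSeries.coeff_coe f 0
  rw [if_neg (lt_irrefl 0)] at this
  refine Eq.trans this ?_
  simp

lemma pslau_injective : Function.Injective (pslau k) :=
  HahnSeries.ofPowerSeries_injective

/-- `X` as a unit. -/
def lsX0 : (LaurentSeries k)ˣ where
  val := HahnSeries.single 1 1
  inv := HahnSeries.single (-1) 1
  val_inv := by simp
  inv_val := by simp

/-- `X` as a unit. -/
def lsX : (LK k)ˣ := lsX0 k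

/-- The inclusion of Laurent polynomials in Laurent series. -/
def lplau : LaurentPolynomial k →ₐ[k] LK k := lauHom (lsX k)

lemma lsX_zpow (n : ℤ) : ((lsX k ^ n : (LK k)ˣ) : LK k) =
    (HahnSeries.single n 1 : LaurentSeries k) := by
  have : ((lsX0 k ^ n : (LaurentSeries k)ˣ) : LaurentSeries k) =
      (HahnSeries.single n 1 : LaurentSeries k) := by
    rw [Units.val_zpow_eq_zpow_val]
    exact (RatFunc.single_zpow n).symm
  exact this

lemma lplau_coeff (p : LaurentPolynomial k) (n : ℤ) : LK.coeff n (lplau k p) = p.coeff n := by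
  induction p using LaurentPolynomial.induction_on' with
  | add p q hp hq => rw [map_add, map_add, hp, hq]; rfl
  | C_mul_T m a =>
    rw [map_mul, LaurentPolynomial.C_eq_algebraMap, (lplau k).commutes, lplau, lauHom_T,
      ← LaurentPolynomial.C_eq_algebraMap, ← LaurentPolynomial.single_eq_C_mul_T]
    have e : algebraMap k (LK k) a * ((lsX k ^ m : (LK k)ˣ) : LK k) =
        (HahnSeries.C a * HahnSeries.single m 1 : LaurentSeries k) :=
      (LK.algebraMap_mul a _).trans
        (congrArg (fun z : LaurentSeries k => HahnSeries.C a * z) (lsX_zpow k m))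
    refine (congrArg (LK.coeff n) e).trans ?_
    change (HahnSeries.C a * HahnSeries.single m 1 : LaurentSeries k).coeff n = _
    rw [HahnSeries.C_mul_eq_smul, HahnSeries.coeff_smul, HahnSeries.coeff_single]
    rw [AddMonoidAlgebra.coeff_single, Finsupp.single_apply]
    by_cases h : m = n
    · subst h; simp
    · rw [if_neg h, if_neg (fun h' => h h'.symm), smul_zero]

lemma lplau_injective : Function.Injective (lplau k) := by
  intro p q h
  ext n
  rw [← lplau_coeff, ← lplau_coeff, h]

variable {k} in
/-- The infinitesimal dilation on Laurent polynomials. -/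
def dualUnit (c : k) {S : Type} [CommRing S] [Algebra k S] (x : Sˣ) : (DualNumber S)ˣ where
  val := TrivSqZeroExt.inl (x : S) + TrivSqZeroExt.inr (c • (x : S))
  inv := TrivSqZeroExt.inl ((x⁻¹ : Sˣ) : S) - TrivSqZeroExt.inr (c • ((x⁻¹ : Sˣ) : S))
  val_inv := TrivSqZeroExt.ext (by simp) (by simp)
  inv_val := TrivSqZeroExt.ext (by simp) (by simp)

/-- `T` as a unit. -/
def lpT : (LaurentPolynomial k)ˣ where
  val := LaurentPolynomial.T 1
  inv := LaurentPolynomial.T (-1)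
  val_inv := by rw [← LaurentPolynomial.T_add]; simp
  inv_val := by rw [← LaurentPolynomial.T_add]; simp

variable {k}

/-- Infinitesimal dilation. -/
def tauR (c : k) : LaurentPolynomial k →ₐ[k] DualNumber (LaurentPolynomial k) :=
  lauHom (dualUnit c (lpT k))

lemma tauR_T (c : k) : tauR c (LaurentPolynomial.T 1) =
    TrivSqZeroExt.inl (LaurentPolynomial.T 1) +
      TrivSqZeroExt.inr (c • (LaurentPolynomial.T 1 : LaurentPolynomial k)) := by
  rw [tauR, lauHom_T, zpow_one]; rfl

/-- Infinitesimal dilation. -/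
def tauO (c : k) : PowerSeries k →ₐ[k] DualNumber (PowerSeries k) where
  toFun f := TrivSqZeroExt.inl f +
    TrivSqZeroExt.inr (c • (PowerSeries.X * PowerSeries.derivative k f))
  map_one' := TrivSqZeroExt.ext (by simp) (by simp)
  map_zero' := TrivSqZeroExt.ext (by simp) (by simp)
  map_add' x y := TrivSqZeroExt.ext (by simp) (by simp [mul_add])
  map_mul' x y := TrivSqZeroExt.ext (by simp) (by
    simp only [TrivSqZeroExt.snd_mul, TrivSqZeroExt.snd_add, TrivSqZeroExt.snd_inl,
      TrivSqZeroExt.snd_inr, TrivSqZeroExt.fst_add, TrivSqZeroExt.fst_inl, TrivSqZeroExt.fst_inr,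
      Derivation.leibniz, smul_eq_mul, PowerSeries.smul_eq_C_mul, zero_add, add_zero,
      op_smul_eq_smul]
    ring)
  commutes' r := TrivSqZeroExt.ext (by simp [TrivSqZeroExt.algebraMap_eq_inl'])
    (by simp [TrivSqZeroExt.algebraMap_eq_inl'])

lemma tauO_fst (c : k) (f) : (tauO c f).fst = f := by simp [tauO]

lemma tauO_snd (c : k) (f) :
    (tauO c f).snd = c • (PowerSeries.X * PowerSeries.derivative k f) := by simp [tauO]

lemma exists_tauK (c : k) : ∃ τ : LK k →ₐ[k] DualNumber (LK k),
    τ.comp (pslau k) = (dualMap (pslau k)).comp (tauO c) ∧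
    τ.comp (lplau k) = (dualMap (lplau k)).comp (tauR c) := by
  have hX : pslau k PowerSeries.X = (lsX k : LK k) := PowerSeries.coe_X
  have hu0 : ((dualMap (pslau k)).comp (tauO c)) PowerSeries.X =
      (dualUnit c (lsX k) : DualNumber (LK k)) := by
    refine TrivSqZeroExt.ext ?_ ?_
    · simp [tauO_fst, hX, dualUnit]
    · simp [tauO_snd, hX, dualUnit]
  have hu : ∀ y : Submonoid.powers (PowerSeries.X : PowerSeries k),
      IsUnit (((dualMap (pslau k)).comp (tauO c)).toRingHom y) := by
    rintro ⟨_, n, rfl⟩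
    change IsUnit (((dualMap (pslau k)).comp (tauO c)) (PowerSeries.X ^ n))
    rw [map_pow, hu0]
    exact (Units.isUnit _).pow n
  let τ0 : LK k →+* DualNumber (LK k) :=
    IsLocalization.lift (M := Submonoid.powers (PowerSeries.X : PowerSeries k)) hu
  have h0 : ∀ f, τ0 (pslau k f) = ((dualMap (pslau k)).comp (tauO c)) f :=
    fun f => IsLocalization.lift_eq hu f
  let τ : LK k →ₐ[k] DualNumber (LK k) :=
    { τ0 with
      commutes' := fun r => by
        change τ0 _ = _
        rw [← (pslau k).commutes, h0, AlgHom.commutes] }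
  refine ⟨τ, AlgHom.ext h0, lauHom_ext ?_⟩
  have h1 : lplau k (LaurentPolynomial.T 1) = (lsX k : LK k) := by
    rw [lplau, lauHom_T, zpow_one]
  change τ0 (lplau k (LaurentPolynomial.T 1)) = dualMap (lplau k) (tauR c (LaurentPolynomial.T 1))
  rw [h1, ← hX, h0, hu0, tauR_T]
  refine TrivSqZeroExt.ext ?_ ?_
  · simp [h1, dualUnit]
  · simp [h1, dualUnit]

/-- The inversion. -/
def lpInv (k : Type) [Field k] : LaurentPolynomial k →ₐ[k] LaurentPolynomial k := lauHom (lpT k)⁻¹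

lemma lpInv_coeff (p : LaurentPolynomial k) (n : ℤ) : (lpInv k p).coeff n = p.coeff (-n) := by
  have hT (m : ℤ) : (((lpT k)⁻¹ ^ m : (LaurentPolynomial k)ˣ) : LaurentPolynomial k) =
      LaurentPolynomial.T (-m) := by
    have key : ∀ m : ℤ, (((lpT k) ^ m : (LaurentPolynomial k)ˣ) : LaurentPolynomial k) =
      LaurentPolynomial.T m := by
      intro m
      have := lauHom_T (k := k) (lpT k) m
      rw [← this]
      have h : lauHom (k := k) (lpT k) = AlgHom.id k _ := lauHom_ext (by
        rw [lauHom_T, zpow_one]; rfl)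
      rw [h]; rfl
    rw [inv_zpow', key]
  induction p using LaurentPolynomial.induction_on' with
  | add p q hp hq =>
    rw [map_add]
    change (lpInv k p).coeff n + (lpInv k q).coeff n = p.coeff (-n) + q.coeff (-n)
    rw [hp, hq]
  | C_mul_T m a =>
    rw [map_mul, LaurentPolynomial.C_eq_algebraMap, (lpInv k).commutes, lpInv, lauHom_T, hT,
      ← LaurentPolynomial.C_eq_algebraMap, ← LaurentPolynomial.single_eq_C_mul_T,
      ← LaurentPolynomial.single_eq_C_mul_T, AddMonoidAlgebra.coeff_single,
      AddMonoidAlgebra.coeff_single, Finsupp.single_apply, Finsupp.single_apply]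
    simp only [neg_eq_iff_eq_neg]

lemma tauR_lpInv (c : k) :
    (tauR (-c)).comp (lpInv k) = (dualMap (lpInv k)).comp (tauR c) := by
  apply lauHom_ext
  have h1 : lpInv k (LaurentPolynomial.T 1) = LaurentPolynomial.T (-1) := by
    rw [lpInv, lauHom_T, zpow_one]; rfl
  have h2 : tauR (-c) (LaurentPolynomial.T (-1)) =
      TrivSqZeroExt.inl (LaurentPolynomial.T (-1)) +
      TrivSqZeroExt.inr (c • (LaurentPolynomial.T (-1) : LaurentPolynomial k)) := by
    rw [tauR, lauHom_T, zpow_neg, zpow_one]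
    refine TrivSqZeroExt.ext ?_ ?_
    · simp [dualUnit]; rfl
    · simp [dualUnit]; rfl
  change tauR (-c) (lpInv k (LaurentPolynomial.T 1)) =
    dualMap (lpInv k) (tauR c (LaurentPolynomial.T 1))
  rw [h1, h2, tauR_T]
  refine TrivSqZeroExt.ext ?_ ?_
  · simp [h1]
  · simp [h1]
end
end

section
/-! ### Morphisms from the multiplicative group -/

/-- An affine chart around the identity through which infinitesimal points factor. -/
lemma exists_chart {k : Type} [Field k] (X : OverR k) (e : ptO k ⟶ X) :
    ∃ (C : Type) (_ : CommRing C) (_ : Algebra k C) (u : SpO k C ⟶ X), Mono u ∧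
      ∀ (S : Type) [CommRing S] [Algebra k S] (δ : SpO k (DualNumber S) ⟶ X),
        SpO.map (dualFst k S) ≫ δ = toPt _ ≫ e →
        ∃ ψ : C →ₐ[k] DualNumber S, δ = SpO.map ψ ≫ u := by
  obtain ⟨U, hU, hxU, -⟩ := exists_isAffineOpen_mem_and_subset
    (X := X.left) (x := e.left (pt0 k)) (U := ⊤) trivial
  let g : CommRingCat.of k ⟶ Γ(X.left, U) := Spec.preimage (hU.fromSpec ≫ X.hom)
  have hg : Spec.map g = hU.fromSpec ≫ X.hom := Spec.map_preimage _
  let _ : Algebra k Γ(X.left, U) := g.hom.toAlgebra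
  have hc : hU.fromSpec ≫ X.hom = (SpO k Γ(X.left, U)).hom := hg.symm
  let u : SpO k Γ(X.left, U) ⟶ X := Over.homMk hU.fromSpec hc
  have hm : Mono u := by
    have : Mono u.left := inferInstanceAs (Mono hU.fromSpec)
    exact Over.mono_of_mono_left u
  refine ⟨Γ(X.left, U), inferInstance, inferInstance, u, hm, ?_⟩
  intro S _ _ δ hδ
  have hr : Set.range δ.left ⊆ Set.range hU.fromSpec := by
    rintro _ ⟨y, rfl⟩
    have hs : Function.Surjective (PrimeSpectrum.comap (dualFst k S).toRingHom) := by
      have hf : Function.Surjective (dualFst k S).toRingHom := fun s => ⟨TrivSqZeroExt.inl s, rfl⟩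
      rw [← Set.range_eq_univ, _root_.range_comap_of_surjective _ _ hf,
        PrimeSpectrum.zeroLocus_eq_univ_iff]
      intro x hx
      have hx0 : x.fst = 0 := hx
      refine ⟨2, ?_⟩
      rw [pow_two]
      exact TrivSqZeroExt.ext (by simp [hx0]) (by simp [hx0])
    obtain ⟨z, rfl⟩ := hs y
    have h1 : δ.left ((SpO.map (dualFst k S)).left z) = e.left ((toPt (SpO k S)).left z) :=
      congrArg (fun q => q.left z) hδ
    rw [hU.range_fromSpec]
    have h2 : (toPt (SpO k S)).left z = pt0 k := pt0_unique k _
    rw [h2] at h1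
    change δ.left ((SpO.map (dualFst k S)).left z) ∈ U
    rw [h1]; exact hxU
  let l : (SpO k (DualNumber S)).left ⟶ (SpO k Γ(X.left, U)).left :=
    IsOpenImmersion.lift hU.fromSpec δ.left hr
  have hl : l ≫ hU.fromSpec = δ.left := IsOpenImmersion.lift_fac _ _ _
  let l' : SpO k (DualNumber S) ⟶ SpO k Γ(X.left, U) := Over.homMk l (by
    rw [← hc, reassoc_of% hl]; exact Over.w δ)
  obtain ⟨ψ, hψ⟩ := SpO.exists_eq_map l'
  refine ⟨ψ, ?_⟩
  rw [← hψ]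
  ext1
  exact hl.symm

/-- Extension over the origin. -/
lemma exists_extension {k : Type} [Field k] (X : OverR k) (hX : UniversallyClosed X.hom)
    (f : SpO k (LK k) ⟶ X) : ∃ g : SpO k (PowerSeries k) ⟶ X, SpO.map (pslau k) ≫ g = f := by
  have h : (ValuativeCriterion.Existence ⊓ @QuasiCompact : MorphismProperty Scheme) X.hom := by
    rw [← UniversallyClosed.eq_valuativeCriterion]; exact hX
  let S : ValuativeCommSq X.hom :=
    { R := PowerSeries k
      K := LK k
      i₁ := f.left
      i₂ := (SpO k (PowerSeries k)).hom
      commSq := ⟨by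
        rw [Over.w f]
        exact (Over.w (SpO.map (pslau k))).symm⟩ }
  obtain ⟨⟨l⟩⟩ := h.1 S
  refine ⟨Over.homMk l.l l.fac_right, ?_⟩
  ext1
  exact l.fac_left

section
variable {k : Type} [Field k] (A : GroupScheme k)

/-- The infinitesimal difference. -/
def infDiff {S : Type} [CommRing S] [Algebra k S] (τ : S →ₐ[k] DualNumber S)
    (f : SpO k S ⟶ A.G) : SpO k (DualNumber S) ⟶ A.G :=
  (SpO.map τ ≫ f) * (SpO.map (dualInl k S) ≫ f)⁻¹

lemma infDiff_fst {S : Type} [CommRing S] [Algebra k S] (τ : S →ₐ[k] DualNumber S)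
    (hτ : (dualFst k S).comp τ = AlgHom.id k S) (f : SpO k S ⟶ A.G) :
    SpO.map (dualFst k S) ≫ infDiff A τ f = toPt _ ≫ (1 : ptO k ⟶ A.G) := by
  have h : (dualFst k S).comp (dualInl k S) = AlgHom.id k S := rfl
  rw [A.comp_one, infDiff, A.comp_mul, A.comp_inv, ← Category.assoc, ← Category.assoc,
    ← SpO.map_comp, ← SpO.map_comp, hτ, h, mul_inv_cancel]

lemma infDiff_map {S S' : Type} [CommRing S] [Algebra k S] [CommRing S'] [Algebra k S']
    (τ : S →ₐ[k] DualNumber S) (τ' : S' →ₐ[k] DualNumber S') (φ : S →ₐ[k] S')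
    (hφ : τ'.comp φ = (dualMap φ).comp τ) (f : SpO k S ⟶ A.G) :
    SpO.map (dualMap φ) ≫ infDiff A τ f = infDiff A τ' (SpO.map φ ≫ f) := by
  have h : (dualInl k S').comp φ = (dualMap φ).comp (dualInl k S) :=
    AlgHom.ext fun x => TrivSqZeroExt.ext (by simp) (by simp)
  rw [infDiff, infDiff, A.comp_mul, A.comp_inv, ← Category.assoc, ← Category.assoc,
    ← Category.assoc, ← Category.assoc, ← SpO.map_comp, ← SpO.map_comp, ← SpO.map_comp,
    ← SpO.map_comp, hφ, h]

lemma tauR_fst (c : k) : (dualFst k _).comp (tauR c) = AlgHom.id k _ :=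
  lauHom_ext (by
    change (tauR c (LaurentPolynomial.T 1)).fst = _
    rw [tauR_T]; simp)

/-- The constant coefficient. -/
def psZero (k : Type) [Field k] : PowerSeries k →ₐ[k] k :=
  { PowerSeries.constantCoeff (R := k) with commutes' := fun r => by simp }

lemma psZero_apply (x : PowerSeries k) : psZero k x = PowerSeries.constantCoeff x := rfl

lemma tauO_psZero (c : k) : (dualInl k k).comp (psZero k) = (dualMap (psZero k)).comp (tauO c) :=
  AlgHom.ext fun x => TrivSqZeroExt.ext (by simp [tauO_fst]) (by simp [tauO_snd, psZero_apply])

variable {C : Type} [CommRing C] [Algebra k C] (u : SpO k C ⟶ A.G)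

/-- The key step: the tangent field is regular and vanishes at the origin. -/
lemma key_step [Mono u] (hA : UniversallyClosed A.G.hom)
    (hu : ∀ (S : Type) [CommRing S] [Algebra k S] (δ : SpO k (DualNumber S) ⟶ A.G),
        SpO.map (dualFst k S) ≫ δ = toPt _ ≫ 1 →
        ∃ ψ : C →ₐ[k] DualNumber S, δ = SpO.map ψ ≫ u)
    (c : k) (f : SpO k (LaurentPolynomial k) ⟶ A.G) :
    ∃ (ψ : C →ₐ[k] DualNumber (LaurentPolynomial k)) (g : SpO k (PowerSeries k) ⟶ A.G)
      (ψ' : C →ₐ[k] DualNumber (PowerSeries k)),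
      infDiff A (tauR c) f = SpO.map ψ ≫ u ∧ infDiff A (tauO c) g = SpO.map ψ' ≫ u ∧
      SpO.map (pslau k) ≫ g = SpO.map (lplau k) ≫ f ∧
      (∀ b, lplau k (ψ b).snd = pslau k (ψ' b).snd) ∧
      ∀ b, ∀ n ≤ 0, (ψ b).snd.coeff n = 0 := by
  obtain ⟨g, hg⟩ := exists_extension A.G hA (SpO.map (lplau k) ≫ f)
  obtain ⟨ψ, hψ⟩ := hu _ _ (infDiff_fst A (tauR c) (tauR_fst c) f)
  obtain ⟨ψ', hψ'⟩ := hu _ _ (infDiff_fst A (tauO c) (AlgHom.ext fun x => tauO_fst c x) g)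
  obtain ⟨τ, h1, h2⟩ := exists_tauK c
  have e1 : (dualMap (lplau k)).comp ψ = (dualMap (pslau k)).comp ψ' := by
    apply SpO.map_injective
    rw [← cancel_mono u, SpO.map_comp, SpO.map_comp, Category.assoc, Category.assoc, ← hψ, ← hψ',
      infDiff_map A _ τ _ h2, infDiff_map A _ τ _ h1, hg]
  have e1' : ∀ b, lplau k (ψ b).snd = pslau k (ψ' b).snd := fun b => by
    have := congrArg TrivSqZeroExt.snd (DFunLike.congr_fun e1 b)
    simpa using this
  have e2 : ∀ b, PowerSeries.constantCoeff (ψ' b).snd = 0 := by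
    have h3 : SpO.map (dualMap (psZero k)) ≫ SpO.map ψ' ≫ u = 1 := by
      rw [← hψ', infDiff_map A _ _ _ (tauO_psZero c), infDiff, mul_inv_cancel]
    have h4 : SpO.map (dualInl k k) ≫ SpO.map (dualFst k k) ≫
        SpO.map (dualMap (psZero k)) ≫ SpO.map ψ' ≫ u = 1 := by
      rw [h3, A.comp_one, A.comp_one]
    have h5 : (dualMap (psZero k)).comp ψ' =
        (dualInl k k).comp ((dualFst k k).comp ((dualMap (psZero k)).comp ψ')) := by
      apply SpO.map_injective
      rw [← cancel_mono u, SpO.map_comp, Category.assoc, h3, ← h4, SpO.map_comp, SpO.map_comp,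
        SpO.map_comp]
      simp only [Category.assoc]
    intro b
    have := congrArg TrivSqZeroExt.snd (DFunLike.congr_fun h5 b)
    simpa [psZero_apply] using this
  refine ⟨ψ, g, ψ', hψ, hψ', hg, e1', ?_⟩
  intro b n hn
  rw [← lplau_coeff, e1']
  obtain hn | rfl := lt_or_eq_of_le hn
  · exact pslau_coeff_neg k _ n hn
  · rw [pslau_coeff_zero, e2]

lemma tau_trivial [Mono u] (hA : UniversallyClosed A.G.hom)
    (hu : ∀ (S : Type) [CommRing S] [Algebra k S] (δ : SpO k (DualNumber S) ⟶ A.G),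
        SpO.map (dualFst k S) ≫ δ = toPt _ ≫ 1 →
        ∃ ψ : C →ₐ[k] DualNumber S, δ = SpO.map ψ ≫ u)
    (f : SpO k (LaurentPolynomial k) ⟶ A.G) :
    ∃ g : SpO k (PowerSeries k) ⟶ A.G, SpO.map (pslau k) ≫ g = SpO.map (lplau k) ≫ f ∧
      SpO.map (tauO 1) ≫ g = SpO.map (dualInl k _) ≫ g := by
  obtain ⟨ψ, g, ψ', hψ, hψ', hg, e1, e2⟩ := key_step A u hA hu 1 f
  obtain ⟨φ, -, -, hφ, -, -, -, e3⟩ := key_step A u hA hu (-1) (SpO.map (lpInv k) ≫ f)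
  have h1 : φ = (dualMap (lpInv k)).comp ψ := by
    apply SpO.map_injective
    rw [← cancel_mono u, SpO.map_comp, Category.assoc, ← hφ, ← hψ,
      infDiff_map A _ _ _ (tauR_lpInv 1)]
  have h2 : ∀ b, (ψ b).snd = 0 := by
    intro b
    ext n
    obtain hn | hn := le_total n 0
    · exact e2 b n hn
    · have := e3 b (-n) (by omega)
      rw [h1] at this
      have h4 : (lpInv k (ψ b).snd).coeff (-n) = 0 := by simpa using this
      rw [lpInv_coeff, neg_neg] at h4
      exact h4
  have h3 : ∀ b, (ψ' b).snd = 0 := fun b => by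
    apply pslau_injective k
    rw [← e1, h2, map_zero, map_zero]
  refine ⟨g, hg, ?_⟩
  have h4 : ψ' = (dualInl k _).comp ((dualFst k _).comp ψ') :=
    AlgHom.ext fun b => TrivSqZeroExt.ext (by simp) (by simp [h3])
  have h5 : infDiff A (tauO 1) g = 1 := by
    rw [hψ', h4, SpO.map_comp, SpO.map_comp, Category.assoc, Category.assoc, ← hψ',
      infDiff_fst A (tauO 1) (AlgHom.ext fun x => tauO_fst 1 x) g, A.comp_one, A.comp_one]
  exact mul_inv_eq_one.1 h5

end

/-- Every morphism from the multiplicative group to a proper group scheme is constant. -/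
lemma gm_constant {k : Type} [Field k] [CharZero k] (A : GroupScheme k) (hA : IsProper A.G.hom)
    (f : SpO k (LaurentPolynomial k) ⟶ A.G) :
    ∃ y : ptO k ⟶ A.G, f = toPt _ ≫ y := by
  obtain ⟨C, _, _, u, _, hu⟩ := exists_chart A.G 1
  obtain ⟨g, hg, hτ⟩ := tau_trivial A u inferInstance hu f
  obtain ⟨O, _, _, _, c, _, -, hO, -⟩ :=
    exists_localRing A.G (g.left (IsLocalRing.closedPoint (PowerSeries k)))
  obtain ⟨α, -, hα⟩ := hO _ g rfl
  have h1 : (tauO 1).comp α = (dualInl k _).comp α := by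
    apply SpO.map_injective
    rw [← cancel_mono c, SpO.map_comp, SpO.map_comp, Category.assoc, Category.assoc, ← hα, hτ]
  have h2 : ∀ b, PowerSeries.derivative k (α b) = 0 := by
    intro b
    have := congrArg TrivSqZeroExt.snd (DFunLike.congr_fun h1 b)
    simp only [AlgHom.comp_apply, tauO_snd, one_smul, dualInl_snd] at this
    exact (mul_eq_zero.1 this).resolve_left PowerSeries.X_ne_zero
  have h3 : α = (Algebra.ofId k _).comp ((psZero k).comp α) := by
    refine AlgHom.ext fun b => ?_
    refine PowerSeries.derivative.ext ?_ ?_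
    · rw [h2]
      change 0 = PowerSeries.derivative k (algebraMap k _ _)
      rw [Derivation.map_algebraMap]
    · change _ = PowerSeries.constantCoeff (algebraMap k (PowerSeries k) _)
      simp [psZero_apply]
  let y : SpO k k ⟶ A.G := SpO.map ((psZero k).comp α) ≫ c
  have h4 : g = SpO.toK k _ ≫ y :=
    hα.trans ((congrArg (fun q => SpO.map q ≫ c) h3).trans (by
      rw [SpO.map_comp, Category.assoc]))
  let i : ptO k ⟶ SpO k k := Over.homMk (𝟙 (SR k)) (by
    have : (SpO k k).hom = 𝟙 (SR k) := Spec.map_id _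
    rw [this]; rfl)
  have hi : ∀ (S : Type) [CommRing S] [Algebra k S], toPt (SpO k S) ≫ i = SpO.toK k S := by
    intro S _ _
    ext1
    exact Category.comp_id _
  refine ⟨i ≫ y, ?_⟩
  ext1
  have hd : IsDominant (SpO.map (lplau k)).left := by
    refine ⟨?_⟩
    refine (PrimeSpectrum.denseRange_comap_iff_ker_le_nilRadical (lplau k).toRingHom).2 ?_
    have : RingHom.ker (lplau k).toRingHom = ⊥ :=
      (RingHom.injective_iff_ker_eq_bot _).1 (lplau_injective k)
    rw [this]
    exact bot_le
  have hr : IsReduced (SpO k (LaurentPolynomial k)).left :=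
    inferInstanceAs (IsReduced (Spec (CommRingCat.of (LaurentPolynomial k))))
  refine ext_of_isDominant_of_isSeparated A.G.hom ?_ (SpO.map (lplau k)).left ?_
  · exact (Over.w f).trans (Over.w (toPt _ ≫ i ≫ y)).symm
  · have h5 : SpO.map (lplau k) ≫ f = SpO.map (lplau k) ≫ toPt _ ≫ i ≫ y := by
      rw [← hg, h4, ← Category.assoc (SpO.map (lplau k)), comp_toPt, ← hi, Category.assoc,
        ← Category.assoc (SpO.map (pslau k)), comp_toPt]
    exact congrArg (fun q => q.left) h5
end

lemma comp_toPt_comp {k : Type} [Field k] {T T' Y : OverR k} (f : T ⟶ T') (y : ptO k ⟶ Y) :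
    f ≫ toPt T' ≫ y = toPt T ≫ y := by
  rw [← Category.assoc, comp_toPt]

lemma toPt_ptO (k : Type) [Field k] : toPt (ptO k) = 𝟙 _ := by
  ext1; rfl

/-- Transfer of constancy along a monomorphism, given a rational point. -/
lemma constant_of_comp {k : Type} [Field k] {T X Y : OverR k} (p : ptO k ⟶ T) (f : T ⟶ X)
    (ι : X ⟶ Y) [Mono ι] (c : ptO k ⟶ Y) (h : f ≫ ι = toPt T ≫ c) : IsConstant f := by
  refine IsConstant.of_eq (y := p ≫ f) ?_
  rw [← cancel_mono ι, h, Category.assoc, Category.assoc, h, comp_toPt_comp, toPt_ptO,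
    Category.id_comp]

lemma not_constant {k : Type} [Field k] (A B : GroupScheme k) (X : OverR k) (ι : X ⟶ A.G)
    (j : B.G ⟶ A.G) (hj : IsClosedImmersion j.left) (hB : Nontrivial B.G.left)
    (a : ptO k ⟶ A.G) (h : B.G ⟶ X) (hh : h ≫ ι = (toPt B.G ≫ a) * j) : ¬ IsConstant h := by
  intro hc
  have : Epi B.G.hom := by
    have hs : (1 : ptO k ⟶ B.G).left ≫ B.G.hom = 𝟙 (SR k) := Over.w (1 : ptO k ⟶ B.G)
    have : IsSplitEpi B.G.hom := IsSplitEpi.mk' ⟨_, hs⟩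
    infer_instance
  obtain ⟨y, rfl⟩ := (isConstant_iff h).1 hc
  have e : j = toPt B.G ≫ (a⁻¹ * (y ≫ ι)) := by
    rw [A.comp_mul, A.comp_inv, ← Category.assoc, hh, inv_mul_cancel_left]
  obtain ⟨x, x', hx⟩ := hB.exists_pair_ne
  refine hx (j.left.isClosedEmbedding.injective ?_)
  have e1 : ∀ z : B.G.left, j.left z = (a⁻¹ * (y ≫ ι)).left (pt0 k) := by
    intro z
    refine (congrArg (fun q => q.left z) e).trans ?_
    exact congrArg (a⁻¹ * (y ≫ ι)).left (pt0_unique k ((toPt B.G).left z))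
  exact (e1 x).trans (e1 x').symm

lemma abelian_case {k : Type} [Field k] [IsAlgClosed k] [CharZero k]
    (A : GroupScheme k) (hA : A.IsAbelianVariety)
    (X : OverR k) (ι : X ⟶ A.G) (hι : IsClosedImmersion ι.left)
    (Γ : GroupScheme k) (hΓ : Γ.IsAbelianVariety) (f : Γ.G ⟶ X)
    (H : ¬ ∃ (B : GroupScheme k) (j : B.G ⟶ A.G),
          B.IsAbelianVariety ∧ IsClosedImmersion j.left ∧
          (∀ {T : OverR k} (a b : T ⟶ B.G), B.mul a b ≫ j = A.mul (a ≫ j) (b ≫ j)) ∧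
          Nontrivial B.G.left ∧
          ∃ (a : ptO k ⟶ A.G) (h : B.G ⟶ X), h ≫ ι = A.mul (toPt B.G ≫ a) j) :
    IsConstant f := by
  let c : ptO k ⟶ A.G := 1 ≫ f ≫ ι
  let g : Γ.G ⟶ A.G := (toPt Γ.G ≫ c)⁻¹ * (f ≫ ι)
  have hg : (1 : ptO k ⟶ Γ.G) ≫ g = 1 := by
    rw [A.comp_mul, A.comp_inv, comp_toPt_comp, toPt_ptO, Category.id_comp, inv_mul_cancel]
  have hfg : f ≫ ι = (toPt Γ.G ≫ c) * g := (mul_inv_cancel_left _ _).symm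
  obtain ⟨B, j, π, hB, hj, hjm, hπ, hd⟩ := GroupScheme.exists_image Γ A hΓ hA.2 g
    (GroupScheme.map_mul_of_map_one Γ A hΓ hA.2 g hg)
  have hm : Mono ι := by
    have : Mono ι.left := inferInstance
    exact Over.mono_of_mono_left ι
  by_cases hn : Nontrivial B.G.left
  · exfalso
    refine H ⟨B, j, hB, hj, hjm, hn, c, ?_⟩
    refine exists_lift_of_dominant π ((toPt B.G ≫ c) * j) f ι ?_
    rw [A.comp_mul, comp_toPt_comp, hπ, hfg]
  · have hs : Subsingleton B.G.left := not_nontrivial_iff_subsingleton.1 hn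
    have := hΓ.1.1
    have := hA.1.1
    have := hA.2
    have : IsReduced Γ.G.left := Γ.isReduced
    have hg1 : g = toPt Γ.G ≫ (1 : ptO k ⟶ A.G) := by
      ext1
      have hl : LocallyOfFiniteType (g.left ≫ A.G.hom) := by rw [Over.w g]; infer_instance
      refine ext_of_apply_eq A.G.hom Set.univ isOpen_univ.isLocallyClosed dense_univ ?_ ?_
      · intro x _ _
        have hg' : g = π ≫ j := hπ.symm
        have e1 : g.left x = j.left (π.left x) := congrArg (fun q => q.left x) hg'
        have e2 : g.left ((1 : ptO k ⟶ Γ.G).left (pt0 k)) = j.left (π.left _) :=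
          congrArg (fun q => q.left ((1 : ptO k ⟶ Γ.G).left (pt0 k))) hg'
        have e3 : g.left ((1 : ptO k ⟶ Γ.G).left (pt0 k)) = (1 : ptO k ⟶ A.G).left (pt0 k) :=
          congrArg (fun q => q.left (pt0 k)) hg
        refine e1.trans (((congrArg j.left (Subsingleton.elim _ _)).trans e2.symm).trans
          (e3.trans ?_))
        exact (congrArg (1 : ptO k ⟶ A.G).left (pt0_unique k ((toPt Γ.G).left x))).symm
      · exact (Over.w g).trans (Over.w (toPt Γ.G ≫ (1 : ptO k ⟶ A.G))).symm
    refine constant_of_comp 1 f ι c ?_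
    rw [hfg, hg1, A.comp_one, mul_one]

/-- Let `k` be an algebraically closed field of characteristic zero, let
`A` be an abelian variety over `k` and let `X ⊆ A` be a closed subvariety. Then `X` is
groupless over `k` if and only if the special locus `Sp(X)` is empty, i.e. `X` contains no
translate `a + B` of a positive-dimensional abelian subvariety `B ⊆ A`. -/
theorem stmt_7 (k : Type) [Field k] [IsAlgClosed k] [CharZero k]
    (A : GroupScheme k) (hA : A.IsAbelianVariety)
    (X : OverR k) (hX : IsVarietyOver X) (ι : X ⟶ A.G) (hι : IsClosedImmersion ι.left) :
    IsGroupless k X ↔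
      ¬ ∃ (B : GroupScheme k) (j : B.G ⟶ A.G),
          B.IsAbelianVariety ∧ IsClosedImmersion j.left ∧
          (∀ {T : OverR k} (a b : T ⟶ B.G), B.mul a b ≫ j = A.mul (a ≫ j) (b ≫ j)) ∧
          Nontrivial B.G.left ∧
          ∃ (a : ptO k ⟶ A.G) (h : B.G ⟶ X),
            h ≫ ι = A.mul (Over.homMk B.G.hom (by simp [ptO]) ≫ a) j := by
  constructor
  · rintro ⟨-, h2⟩ ⟨B, j, hB, hj, -, hn, a, h, hh⟩
    exact not_constant A B X ι j hj hn a h hh (h2 B hB h)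
  · intro H
    refine ⟨fun f => ?_, fun Γ hΓ f => abelian_case A hA X ι hι Γ hΓ f H⟩
    obtain ⟨y, hy⟩ := gm_constant A hA.2 (f ≫ ι)
    have hm : Mono ι := by
      have : Mono ι.left := inferInstance
      exact Over.mono_of_mono_left ι
    let φ : LaurentPolynomial k →ₐ[k] k := lauHom 1
    let p : ptO k ⟶ SpO k (LaurentPolynomial k) :=
      Over.homMk (SpO.map φ).left ((Over.w (SpO.map φ)).trans (Spec.map_id _))
    exact constant_of_comp (T := SpO k (LaurentPolynomial k)) p f ι y hy

end
end

section
/- Let X be a variety over the algebraic closure of ℚ. Then X is arithmetically hyperbolic over Q̄ if and only if for every arithmetic curve C = Spec O_{K,S} (K a number field, S a finite set of finite places), every closed point c of C, every model 𝒳 of X over C, and every closed point x of 𝒳, the set of morphisms f : C → 𝒳 over C with f(c) = x is finite. -/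
/-!
Formalization of a statement from "The Lang–Vojta conjectures on projective
pseudo-hyperbolic varieties" (Javanpeykar).

Notions not available in Mathlib (analytifications, genus, ample degrees, Hom-schemes, ...)
are encoded by explicit definitions or structures below; see the docstrings for the
conventions used.
-/

open CategoryTheory AlgebraicGeometry Limits

noncomputable section

/-- The unique point of `Spec k`, for `k` a field. -/
def specPt (k : Type) [Field k] : SR k := (⟨⊥, Ideal.bot_prime⟩ : PrimeSpectrum k)

/-- A model of `X` over a subring `A ⊆ k`: a finite type separated scheme over `Spec A`
together with an identification of its base change to `k` with `X`. -/
structure SchemeModel (k : Type) [Field k] (A : Subring k) (X : OverR k) where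
  M : Scheme
  str : M ⟶ SR ↥A
  lft : LocallyOfFiniteType str
  qc : QuasiCompact str
  sep : IsSeparated str
  base : pullback str (Spec.map (CommRingCat.ofHom A.subtype)) ≅ X.left
  base_w : base.hom ≫ X.hom = pullback.snd str (Spec.map (CommRingCat.ofHom A.subtype))

/-- `x` is the `k`-point of `X` induced (via the base change identification) by the
`k`-valued point `m` of the model. -/
def SchemeModel.InducesPoint {k : Type} [Field k] {A : Subring k} {X : OverR k}
    (𝒳 : SchemeModel k A X) (m : SR k ⟶ 𝒳.M) (x : X.left) : Prop :=
  ∃ q : SR k ⟶ X.left,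
    q ≫ 𝒳.base.inv ≫ pullback.fst 𝒳.str (Spec.map (CommRingCat.ofHom A.subtype)) = m ∧
    q ≫ 𝒳.base.inv ≫ pullback.snd 𝒳.str (Spec.map (CommRingCat.ofHom A.subtype)) = 𝟙 (SR k) ∧
    x = q.base (specPt k)

/-- Every positive-dimensional irreducible component of the closure of `s` is contained
in `Δ`. -/
def ComponentsModulo {X : Scheme} (Δ s : Set X) : Prop :=
  ∀ T : Set X, IsIrreducible T → IsClosed T → T ⊆ closure s →
    (∀ T' : Set X, IsIrreducible T' → IsClosed T' → T' ⊆ closure s → T ⊆ T' → T = T') →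
    ¬ T.Subsingleton → T ⊆ Δ

/-- `X` is arithmetically hyperbolic modulo `Δ` over `k`: for every finitely generated
subring `A ⊆ k` and every model `𝒳` of `X` over `A`, every positive-dimensional
irreducible component of the Zariski closure of the set of `A`-points `𝒳(A)` in `X`
is contained in `Δ`. -/
def ArithmeticallyHyperbolicModulo (k : Type) [Field k] (X : OverR k) (Δ : Set X.left) :
    Prop :=
  ∀ A : Subring k, Algebra.FiniteType ℤ ↥A →
    ∀ 𝒳 : SchemeModel k A X,
      ComponentsModulo Δ {x : X.left | ∃ s : SR ↥A ⟶ 𝒳.M, s ≫ 𝒳.str = 𝟙 (SR ↥A) ∧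
        𝒳.InducesPoint (Spec.map (CommRingCat.ofHom A.subtype) ≫ s) x}

/-- A finite field has finitely many points on an algebra of finite type over a ring. -/
lemma aux_finite_ringHom {R B κ : Type} [CommRing R] [CommRing B] [CommRing κ] [Finite κ]
    (ψ : R →+* B) (hψ : ψ.FiniteType) (i : R →+* κ) :
    Finite {φ : B →+* κ // φ.comp ψ = i} := by
  algebraize [ψ, i]
  obtain ⟨s, hs⟩ := (show Algebra.FiniteType R B from hψ).out
  have : Finite (s → κ) := inferInstance
  refine Finite.of_injective (fun φ : {φ : B →+* κ // φ.comp ψ = i} => fun x : s => φ.1 x.1) ?_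
  intro φ φ' h
  let a : B →ₐ[R] κ := { φ.1 with commutes' := fun r => RingHom.congr_fun φ.2 r }
  let b : B →ₐ[R] κ := { φ'.1 with commutes' := fun r => RingHom.congr_fun φ'.2 r }
  have hab : a = b := by
    apply AlgHom.ext_of_adjoin_eq_top hs
    intro x hx
    exact congrFun h ⟨x, hx⟩
  apply Subtype.ext
  ext x
  exact congrArg (fun f : B →ₐ[R] κ => f x) hab

lemma aux_finite_affine {R κ : Type} [CommRing R] [CommRing κ] [Finite κ] (B : CommRingCat.{0})
    (p : Spec B ⟶ SR R) [LocallyOfFiniteType p] (i : SR κ ⟶ SR R) :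
    Finite {h : SR κ ⟶ Spec B // h ≫ p = i} := by
  have hp : (Spec.preimage p).hom.FiniteType := by
    rw [← HasRingHomProperty.Spec_iff (P := @LocallyOfFiniteType), Spec.map_preimage]
    infer_instance
  have := aux_finite_ringHom _ hp (Spec.preimage i).hom
  refine Finite.of_injective (β := {φ : B →+* κ // φ.comp (Spec.preimage p).hom =
    (Spec.preimage i).hom}) (fun h => ⟨(Spec.preimage h.1).hom, ?_⟩) ?_
  · rw [← CommRingCat.hom_comp]
    congr 1
    apply Spec.map_injective
    simp [h.2]
  · intro h h' e
    have e1 := congrArg Subtype.val e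
    apply Subtype.ext
    rw [← Spec.map_preimage h.1, ← Spec.map_preimage h'.1]
    congr 1
    exact CommRingCat.hom_ext e1

lemma aux_finite_points {R κ : Type} [CommRing R] [Field κ] [Finite κ] {M : Scheme.{0}}
    (p : M ⟶ SR R) [LocallyOfFiniteType p] [QuasiCompact p] (i : SR κ ⟶ SR R) :
    Finite {h : SR κ ⟶ M // h ≫ p = i} := by
  have : CompactSpace M := QuasiCompact.compactSpace_of_compactSpace p
  let 𝒰 := M.affineCover.finiteSubcover
  have hfin (j : 𝒰.I₀) : Finite {h : SR κ ⟶ 𝒰.X j // h ≫ 𝒰.f j ≫ p = i} := by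
    have h1 : IsOpenImmersion (𝒰.f j) := 𝒰.map_prop j
    have h2 : LocallyOfFiniteType (𝒰.f j ≫ p) := locallyOfFiniteType_comp _ _
    exact @aux_finite_affine R κ _ _ _ _ (𝒰.f j ≫ p) h2 i
  refine Finite.of_surjective
    (fun a : (Σ j : 𝒰.I₀, {h : SR κ ⟶ 𝒰.X j // h ≫ 𝒰.f j ≫ p = i}) =>
      (⟨a.2.1 ≫ 𝒰.f a.1, by simpa using a.2.2⟩ : {h : SR κ ⟶ M // h ≫ p = i})) ?_
  rintro ⟨g, hg⟩
  obtain ⟨j, hj⟩ : ∃ j, g (specPt κ) ∈ Set.range (𝒰.f j) :=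
    ⟨_, 𝒰.covers _⟩
  have hr : Set.range g ⊆ Set.range (𝒰.f j) := by
    rintro _ ⟨y, rfl⟩
    have : Subsingleton (SR κ) := inferInstanceAs (Subsingleton (PrimeSpectrum κ))
    rwa [Subsingleton.elim y (specPt κ)]
  refine ⟨⟨j, IsOpenImmersion.lift (𝒰.f j) g hr, ?_⟩, ?_⟩
  · rw [IsOpenImmersion.lift_fac_assoc, hg]
  · exact Subtype.ext (IsOpenImmersion.lift_fac _ _ _)

lemma aux_jacobson_int : IsJacobsonRing ℤ := by
  rw [isJacobsonRing_iff_prime_eq]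
  intro P hP
  by_cases h : P = ⊥
  · subst h
    rw [eq_bot_iff]
    intro n hn
    by_contra hn0
    have hn0 : n ≠ 0 := hn0
    obtain ⟨p, hp, hpp⟩ := Nat.exists_infinite_primes (n.natAbs + 1)
    have hmax : (Ideal.span {(p : ℤ)}).IsMaximal :=
      PrincipalIdealRing.isMaximal_of_irreducible (Nat.prime_iff_prime_int.mp hpp).irreducible
    have h1 : n ∈ Ideal.span {(p : ℤ)} := by
      rw [Ideal.jacobson, Ideal.mem_sInf] at hn
      exact hn ⟨bot_le, hmax⟩
    rw [Ideal.mem_span_singleton] at h1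
    have h2 := Int.natAbs_dvd_natAbs.mpr h1
    have h3 := Nat.le_of_dvd (Int.natAbs_pos.mpr hn0) h2
    simp at h3
    omega
  · have := hP.isMaximal h
    exact Ideal.jacobson_eq_self_of_isMaximal

/-- A field which is finitely generated as a ring is finite. -/
lemma aux_finite_field (κ : Type) [Field κ] [Algebra.FiniteType ℤ κ] : Finite κ := by
  have := aux_jacobson_int
  have hf : Module.Finite ℤ κ := finite_of_finite_type_of_isJacobsonRing ℤ κ
  have hinj : ¬ Function.Injective (algebraMap ℤ κ) := fun h =>
    Int.not_isField (isField_of_isIntegral_of_isField h (Field.toIsField κ))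
  rw [injective_iff_map_eq_zero] at hinj
  push Not at hinj
  obtain ⟨n, hn, hn0⟩ := hinj
  apply Module.finite_of_fg_torsion
  intro x
  refine ⟨⟨n, mem_nonZeroDivisors_of_ne_zero hn0⟩, ?_⟩
  change n • x = 0
  rw [Algebra.smul_def, hn, zero_mul]

lemma aux_finite_field_alg (κ : Type) [Field κ] [a : Algebra ℤ κ] [h : Algebra.FiniteType ℤ κ] :
    Finite κ := by
  obtain rfl : a = Ring.toIntAlgebra κ := Subsingleton.elim _ _
  exact aux_finite_field κ

lemma aux_dedekind_ext {k : Type} [Field k] [CharZero k]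
    [Algebra.IsAlgebraic ℚ k] (A : Subring k) (hA : Algebra.FiniteType ℤ A) :
    ∃ B : Subring (k), A ≤ B ∧ Algebra.FiniteType ℤ B ∧ IsDedekindDomain B := by
  obtain ⟨s, hs⟩ := hA.out
  let t : Set (k) := Subtype.val '' (s : Set A)
  have ht : t.Finite := s.finite_toSet.image _
  let K : IntermediateField ℚ (k) := IntermediateField.adjoin ℚ t
  have hK : FiniteDimensional ℚ K :=
    haveI : Finite t := ht
    IntermediateField.finiteDimensional_adjoin (fun x _ => Algebra.IsIntegral.isIntegral x)
  have : NumberField K := { to_charZero := inferInstance, to_finiteDimensional := hK }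
  have hint : ∀ x : k, ∃ y : ℤ, y ≠ 0 ∧ IsIntegral ℤ (y • x) := fun x => by
    have h1 : IsAlgebraic ℚ x := Algebra.IsAlgebraic.isAlgebraic x
    have h2 : IsAlgebraic ℤ x := (IsFractionRing.isAlgebraic_iff ℤ ℚ _).mpr h1
    exact h2.exists_integral_multiple
  choose y hy0 hyi using hint
  let N : ℤ := ∏ x ∈ ht.toFinset, y x
  have hN : N ≠ 0 := Finset.prod_ne_zero_iff.mpr fun x _ => hy0 x
  have hNi : ∀ x ∈ t, IsIntegral ℤ (N • x) := by
    intro x hx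
    obtain ⟨m, hm⟩ : y x ∣ N := Finset.dvd_prod_of_mem y (ht.mem_toFinset.mpr hx)
    rw [hm, mul_comm, mul_smul]
    exact (hyi x).smul m
  let O := NumberField.RingOfIntegers K
  let ι : O →+* k := (algebraMap K (k)).comp (algebraMap O K)
  have hι : Function.Injective ι :=
    (algebraMap K (k)).injective.comp
      NumberField.RingOfIntegers.coe_injective
  have hNO : (N : O) ≠ 0 := by exact_mod_cast hN
  let L := Localization.Away (N : O)
  have hu : IsUnit (ι (N : O)) := by
    rw [isUnit_iff_ne_zero, map_ne_zero_iff _ hι]; exact hNO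
  let F : L →+* k := IsLocalization.Away.lift (N : O) hu
  have hF (o : O) : F (algebraMap O L o) = ι o := IsLocalization.Away.lift_eq _ hu o
  have hle : Submonoid.powers (N : O) ≤ nonZeroDivisors O :=
    powers_le_nonZeroDivisors_of_noZeroDivisors hNO
  have hFinj : Function.Injective F := by
    rw [injective_iff_map_eq_zero]
    intro z hz
    obtain ⟨o, d, rfl⟩ := IsLocalization.exists_mk'_eq (Submonoid.powers (N : O)) z
    have h1 : F (IsLocalization.mk' L o d) * F (algebraMap O L d) = ι o := by
      rw [← map_mul, IsLocalization.mk'_spec, hF]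
    rw [hz, zero_mul, eq_comm, map_eq_zero_iff _ hι] at h1
    rw [h1, IsLocalization.mk'_zero]
  have : IsDomain L := hFinj.isDomain F
  have hDL : IsDedekindDomain L := IsLocalization.isDedekindDomain O hle L
  have hfL : Algebra.FiniteType ℤ L := by
    have h1 : Algebra.FiniteType O L :=
      haveI := IsLocalization.Away.finitePresentation (S := L) (N : O)
      inferInstance
    exact Algebra.FiniteType.trans (S := O) inferInstance h1
  let e : L ≃+* F.range := RingEquiv.ofBijective F.rangeRestrict
    ⟨fun a b h => hFinj (congrArg Subtype.val h), F.rangeRestrict_surjective⟩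
  refine ⟨F.range, ?_, ?_, ?_⟩
  · have hgen : ∀ x ∈ t, x ∈ F.range := by
      intro x hx
      have hxK : x ∈ K := IntermediateField.subset_adjoin ℚ t hx
      have hi : IsIntegral ℤ (N • (⟨x, hxK⟩ : K)) := by
        rw [← isIntegral_algebraMap_iff (B := k)
          (algebraMap K (k)).injective]
        rw [map_zsmul]
        exact hNi x hx
      let o : O := ⟨_, hi⟩
      refine ⟨IsLocalization.mk' L o (⟨(N : O), Submonoid.mem_powers _⟩ :
        Submonoid.powers (N : O)), ?_⟩
      apply hu.mul_right_cancel
      rw [← hF, ← map_mul, IsLocalization.mk'_spec, hF, hF, map_intCast]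
      change algebraMap K (k) (N • (⟨x, hxK⟩ : K)) = _
      rw [map_zsmul, zsmul_eq_mul, mul_comm]
      rfl
    have hcl : (Algebra.adjoin ℤ (s : Set A)) ≤ (subalgebraOfSubring (F.range.comap A.subtype)) := by
      rw [Algebra.adjoin_le_iff]
      intro z hz
      exact hgen _ ⟨z, hz, rfl⟩
    intro x hx
    have : (⟨x, hx⟩ : A) ∈ Algebra.adjoin ℤ (s : Set A) := hs ▸ Algebra.mem_top
    exact hcl this
  · refine Algebra.FiniteType.of_surjective (A := L)
      ({ (e : L →+* F.range) with commutes' := fun n => ?_ } : L →ₐ[ℤ] F.range) e.surjective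
    change e _ = _
    simp
  · let : Algebra L F.range := (e : L →+* F.range).toAlgebra
    have : IsLocalization (⊥ : Submonoid L) F.range :=
      IsLocalization.of_le_isUnit_of_bijective (by simp [Algebra.algebraMapSubmonoid]) e.bijective
    exact IsLocalization.isDedekindDomain L (M := ⊥) bot_le F.range

lemma aux_alg : Algebra.IsAlgebraic ℚ (AlgebraicClosure ℚ) := by
  have h := AlgebraicClosure.isAlgebraic ℚ
  have e : (DivisionRing.toRatAlgebra : Algebra ℚ (AlgebraicClosure ℚ)) =
    AlgebraicClosure.instAlgebra ℚ := Subsingleton.elim _ _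
  rw [e]
  exact h

def aux_baseChange {k : Type} [Field k] {A B : Subring k} (hAB : A ≤ B) {X : OverR k}
    (𝒳 : SchemeModel k A X) : SchemeModel k B X :=
  have := 𝒳.lft
  have := 𝒳.qc
  have := 𝒳.sep
  { M := pullback 𝒳.str (Spec.map (CommRingCat.ofHom (Subring.inclusion hAB)))
    str := pullback.snd _ _
    lft := inferInstance
    qc := inferInstance
    sep := inferInstance
    base := pullbackLeftPullbackSndIso _ _ _ ≪≫
      pullback.congrHom rfl (by rw [← Spec.map_comp]; rfl) ≪≫ 𝒳.base
    base_w := by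
      simp only [Iso.trans_hom, Category.assoc, 𝒳.base_w, pullback.congrHom_hom]
      erw [pullback.lift_snd]
      rw [Category.comp_id]
      exact pullbackLeftPullbackSndIso_hom_snd _ _ _ }

lemma aux_dedekind_case {k : Type} [Field k] (X : OverR k) (A : Subring k)
    (hA : Algebra.FiniteType ℤ A) (𝒳 : SchemeModel k A X)
    (H : ∀ c : SR ↥A, IsClosed ({c} : Set (SR ↥A)) → ∀ x : 𝒳.M, IsClosed ({x} : Set 𝒳.M) →
          Finite {f : SR ↥A ⟶ 𝒳.M // f ≫ 𝒳.str = 𝟙 (SR ↥A) ∧ f.base c = x}) :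
    Finite {s : SR ↥A ⟶ 𝒳.M // s ≫ 𝒳.str = 𝟙 (SR ↥A)} := by
  have := 𝒳.lft
  have := 𝒳.qc
  have := 𝒳.sep
  obtain ⟨m, hm⟩ := Ideal.exists_maximal A
  let : Field (A ⧸ m) := Ideal.Quotient.field m
  have : Algebra.FiniteType ℤ (A ⧸ m) :=
    Algebra.FiniteType.of_surjective (A := A) (Ideal.Quotient.mkₐ ℤ m)
      Ideal.Quotient.mk_surjective
  have : Finite (A ⧸ m) := aux_finite_field_alg _
  let i : SR (A ⧸ m) ⟶ SR A := Spec.map (CommRingCat.ofHom (Ideal.Quotient.mk m))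
  have hcl : IsClosedImmersion i :=
    IsClosedImmersion.spec_of_surjective _ Ideal.Quotient.mk_surjective
  have := aux_finite_points 𝒳.str i
  let pt : SR (A ⧸ m) := specPt _
  have hpt : IsClosed ({pt} : Set (SR (A ⧸ m))) := by
    have : Subsingleton (SR (A ⧸ m)) := inferInstanceAs (Subsingleton (PrimeSpectrum (A ⧸ m)))
    exact (Set.subsingleton_of_subsingleton).isClosed
  have hc : IsClosed ({i pt} : Set (SR A)) := by
    rw [← Set.image_singleton]
    exact i.isClosedEmbedding.isClosedMap _ hpt
  let Φ : {s : SR ↥A ⟶ 𝒳.M // s ≫ 𝒳.str = 𝟙 (SR ↥A)} → {h : SR (A ⧸ m) ⟶ 𝒳.M // h ≫ 𝒳.str = i} :=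
    fun s => ⟨i ≫ s.1, by rw [Category.assoc, s.2, Category.comp_id]⟩
  have key : (Set.univ : Set {s : SR ↥A ⟶ 𝒳.M // s ≫ 𝒳.str = 𝟙 (SR ↥A)}).Finite := by
    refine Set.Finite.of_finite_fibers Φ (Set.toFinite _) ?_
    rintro _ ⟨s, -, rfl⟩
    have hsc : IsClosedImmersion s.1 := by
      have : IsClosedImmersion (s.1 ≫ 𝒳.str) := by rw [s.2]; infer_instance
      exact .of_comp s.1 𝒳.str
    have hx : IsClosed ({s.1 (i pt)} : Set 𝒳.M) := by
      rw [← Set.image_singleton]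
      exact s.1.isClosedEmbedding.isClosedMap _ hc
    have hfin := H _ hc _ hx
    have h2 : Finite ↥(Set.univ ∩ Φ ⁻¹' {Φ s}) := by
      refine Finite.of_injective (β := {f : SR ↥A ⟶ 𝒳.M // f ≫ 𝒳.str = 𝟙 (SR ↥A) ∧
        f.base (i pt) = s.1 (i pt)}) (fun u => ⟨u.1.1, u.1.2, ?_⟩) ?_
      · have hu : i ≫ u.1.1 = i ≫ s.1 := congrArg Subtype.val u.2.2
        have := congrArg (fun f : SR (A ⧸ m) ⟶ 𝒳.M => f pt) hu
        simpa using this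
      · intro u v huv
        have h' := congrArg Subtype.val huv
        exact Subtype.ext (Subtype.ext h')
    exact Set.toFinite _
  exact Set.finite_univ_iff.mp key

lemma aux_sections {k : Type} [Field k] {X : OverR k} {A B : Subring k} (hAB : A ≤ B)
    (𝒳 : SchemeModel k A X)
    (H : Finite {s : SR ↥B ⟶ (aux_baseChange hAB 𝒳).M //
      s ≫ (aux_baseChange hAB 𝒳).str = 𝟙 (SR ↥B)}) :
    Finite {s : SR ↥A ⟶ 𝒳.M // s ≫ 𝒳.str = 𝟙 (SR ↥A)} := by
  have := 𝒳.sep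
  let j : SR B ⟶ SR A := Spec.map (CommRingCat.ofHom (Subring.inclusion hAB))
  have hj : IsDominant j := by
    constructor
    have : Function.Injective (Subring.inclusion hAB) := Subring.inclusion_injective hAB
    have h2 : DenseRange (PrimeSpectrum.comap (Subring.inclusion hAB)) := by
      rw [PrimeSpectrum.denseRange_comap_iff_ker_le_nilRadical,
        (RingHom.injective_iff_ker_eq_bot _).mp this]
      exact bot_le
    exact h2
  have hw (s : {s : SR ↥A ⟶ 𝒳.M // s ≫ 𝒳.str = 𝟙 (SR ↥A)}) :
      (j ≫ s.1) ≫ 𝒳.str = 𝟙 _ ≫ j := by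
    rw [Category.assoc, s.2, Category.comp_id, Category.id_comp]
  refine Finite.of_injective (β := {s : SR ↥B ⟶ (aux_baseChange hAB 𝒳).M //
      s ≫ (aux_baseChange hAB 𝒳).str = 𝟙 (SR ↥B)})
    (fun s => ⟨pullback.lift (j ≫ s.1) (𝟙 _) (hw s), pullback.lift_snd _ _ _⟩) ?_
  intro s s' h
  have h1 : pullback.lift (j ≫ s.1) (𝟙 _) (hw s) = pullback.lift (j ≫ s'.1) (𝟙 _) (hw s') :=
    congrArg Subtype.val h
  have h2 : j ≫ s.1 = j ≫ s'.1 := by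
    rw [← pullback.lift_fst (j ≫ s.1) (𝟙 _) (hw s), h1, pullback.lift_fst]
  exact Subtype.ext (ext_of_isDominant_of_isSeparated 𝒳.str (s.2.trans s'.2.symm) j h2)

/-- Let `X` be a variety over `ℚ̄`. Then `X` is arithmetically
hyperbolic over `ℚ̄` (all models over finitely generated subrings of `ℚ̄` have finitely
many integral points) if and only if, for every arithmetic curve `C = Spec 𝒪_{K,S}`
(encoded as the spectrum of a finitely generated Dedekind subring of `ℚ̄`, which are
exactly the rings of `S`-integers of number fields), every closed point `c` of `C`, every
model `𝒳` of `X` over `C` and every closed point `x` of `𝒳`, the set of morphisms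
`f : C ⟶ 𝒳` over `C` with `f(c) = x` is finite. -/
theorem stmt_14 (X : OverR (AlgebraicClosure ℚ)) (hX : IsVarietyOver X) :
    (∀ A : Subring (AlgebraicClosure ℚ), Algebra.FiniteType ℤ ↥A →
      ∀ 𝒳 : SchemeModel (AlgebraicClosure ℚ) A X,
        Finite {s : SR ↥A ⟶ 𝒳.M // s ≫ 𝒳.str = 𝟙 (SR ↥A)}) ↔
    (∀ A : Subring (AlgebraicClosure ℚ), Algebra.FiniteType ℤ ↥A → IsDedekindDomain ↥A →
      ∀ c : SR ↥A, IsClosed ({c} : Set (SR ↥A)) →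
        ∀ 𝒳 : SchemeModel (AlgebraicClosure ℚ) A X, ∀ x : 𝒳.M,
          IsClosed ({x} : Set 𝒳.M) →
          Finite {f : SR ↥A ⟶ 𝒳.M // f ≫ 𝒳.str = 𝟙 (SR ↥A) ∧ f.base c = x}) := by
  constructor
  · intro H A hA _ c _ 𝒳 x _
    have := H A hA 𝒳
    exact Finite.of_injective (fun f : {f : SR ↥A ⟶ 𝒳.M // f ≫ 𝒳.str = 𝟙 (SR ↥A) ∧ f.base c = x} =>
      (⟨f.1, f.2.1⟩ : {s : SR ↥A ⟶ 𝒳.M // s ≫ 𝒳.str = 𝟙 (SR ↥A)}))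
      (fun f g h => by
        have h' := congrArg Subtype.val h
        exact Subtype.ext h')
  · intro H A hA 𝒳
    have := aux_alg
    obtain ⟨B, hAB, hB, hD⟩ := aux_dedekind_ext A hA
    exact aux_sections hAB 𝒳 (aux_dedekind_case X B hB _ fun c hc x hx =>
      H B hB hD c hc _ x hx)

end
end

section
/- Let k be an algebraically closed field of characteristic zero, let X be a variety over k with an arithmetically-pure model, and let Δ ⊂ X be a closed subset. Then X is Mordellic modulo Δ over k if and only if X is arithmetically hyperbolic modulo Δ over k. -/
/-!
Formalization of a statement from "The Lang–Vojta conjectures on projective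
pseudo-hyperbolic varieties" (Javanpeykar).

Notions not available in Mathlib (analytifications, genus, ample degrees, Hom-schemes, ...)
are encoded by explicit definitions or structures below; see the docstrings for the
conventions used.
-/

open CategoryTheory AlgebraicGeometry Limits

noncomputable section

/-- The fraction field of a subring `A` of a field `k`, realized inside `k`. -/
def fracIn {k : Type} [Field k] (A : Subring k) : Subring k :=
  Subring.closure (↑A ∪ {x : k | ∃ a : ↥A, (a : k) ≠ 0 ∧ x * (a : k) = 1})

lemma le_fracIn {k : Type} [Field k] (A : Subring k) : A ≤ fracIn A :=
  fun _ hx => Subring.subset_closure (Or.inl hx)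

/-- The localization of `A ⊆ k` at a prime ideal `p`, realized inside `k`. -/
def locAt {k : Type} [Field k] (A : Subring k) (p : Ideal ↥A) : Subring k :=
  Subring.closure (↑A ∪ {x : k | ∃ s : ↥A, s ∉ p ∧ (s : k) ≠ 0 ∧ x * (s : k) = 1})

lemma le_locAt {k : Type} [Field k] (A : Subring k) (p : Ideal ↥A) : A ≤ locAt A p :=
  fun _ hx => Subring.subset_closure (Or.inl hx)

lemma locAt_le_fracIn {k : Type} [Field k] (A : Subring k) (p : Ideal ↥A) :
    locAt A p ≤ fracIn A :=
  Subring.closure_mono (Set.union_subset_union_right _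
    (fun _ ⟨s, _, hs0, hxs⟩ => ⟨s, hs0, hxs⟩))

/-- A near-integral `A`-point of a model `𝒳`: a `K(A)`-point (where `K(A)` is the fraction
field of `A` inside `k`) which, at every codimension-one prime of `A`, extends to the
local ring at that prime. -/
def SchemeModel.IsNearIntegralPoint {k : Type} [Field k] {A : Subring k} {X : OverR k}
    (𝒳 : SchemeModel k A X) (P : SR ↥(fracIn A) ⟶ 𝒳.M) : Prop :=
  P ≫ 𝒳.str = Spec.map (CommRingCat.ofHom (Subring.inclusion (le_fracIn A))) ∧
  ∀ p : Ideal ↥A, p.IsPrime → p ≠ ⊥ → (∀ q : Ideal ↥A, q.IsPrime → q < p → q = ⊥) →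
    ∃ Q : SR ↥(locAt A p) ⟶ 𝒳.M,
      Q ≫ 𝒳.str = Spec.map (CommRingCat.ofHom (Subring.inclusion (le_locAt A p))) ∧
      Spec.map (CommRingCat.ofHom (Subring.inclusion (locAt_le_fracIn A p))) ≫ Q = P

/-- `X` is Mordellic modulo `Δ` over `k`: for every finitely generated subring `A ⊆ k`
and every model `𝒳` of `X` over `A`, every positive-dimensional irreducible component of
the Zariski closure of the set of near-integral `A`-points `𝒳(A)^{(1)}` in `X` is
contained in `Δ`. -/
def MordellicModulo (k : Type) [Field k] (X : OverR k) (Δ : Set X.left) : Prop :=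
  ∀ A : Subring k, Algebra.FiniteType ℤ ↥A →
    ∀ 𝒳 : SchemeModel k A X,
      ComponentsModulo Δ {x : X.left | ∃ P : SR ↥(fracIn A) ⟶ 𝒳.M,
        𝒳.IsNearIntegralPoint P ∧
        𝒳.InducesPoint (Spec.map (CommRingCat.ofHom (fracIn A).subtype) ≫ P) x}

/-- A model is pure if morphisms to it from big dense opens of smooth finite type
separated integral `A`-schemes extend (uniquely). -/
def SchemeModel.IsPure {k : Type} [Field k] {A : Subring k} {X : OverR k}
    (𝒳 : SchemeModel k A X) : Prop :=
  ∀ (T : Scheme) (tstr : T ⟶ SR ↥A), IsSmooth tstr → LocallyOfFiniteType tstr →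
    QuasiCompact tstr → IsSeparated tstr → IsIntegral T →
    ∀ (U : T.Opens), Dense (U : Set T) → CodimAtLeastTwo ((U : Set T)ᶜ) →
      ∀ g : U.toScheme ⟶ 𝒳.M, g ≫ 𝒳.str = U.ι ≫ tstr →
        ∃! g' : T ⟶ 𝒳.M, g' ≫ 𝒳.str = tstr ∧ U.ι ≫ g' = g

/-- `X` has an arithmetically-pure model: a pure model over some finitely generated
subring of `k`. -/
def HasArithmeticallyPureModel (k : Type) [Field k] (X : OverR k) : Prop :=
  ∃ A : Subring k, Algebra.FiniteType ℤ ↥A ∧ ∃ 𝒳 : SchemeModel k A X, 𝒳.IsPure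

lemma ComponentsModulo.mono' {X : Scheme} {Δ s t : Set X} (hst : s ⊆ t)
    (h : ComponentsModulo Δ t) : ComponentsModulo Δ s := by
  intro T hT hTc hTs _ hns
  have hTt : T ⊆ closure t := hTs.trans (closure_mono hst)
  -- Zorn
  obtain ⟨M, hM, hMmax⟩ := zorn_subset_nonempty {T' : Set X | IsPreirreducible T' ∧ T' ⊆ closure t}
    (by
      intro c hc hcc hne
      refine ⟨⋃₀ c, ⟨?_, ?_⟩, fun s hs => Set.subset_sUnion_of_mem hs⟩
      · intro U V hU hV ⟨x, hx, hxU⟩ ⟨y, hy, hyV⟩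
        obtain ⟨a, ha, hxa⟩ := hx
        obtain ⟨b, hb, hyb⟩ := hy
        rcases hcc.total ha hb with hab | hab
        · obtain ⟨z, hz, hz'⟩ := (hc hb).1 U V hU hV ⟨x, hab hxa, hxU⟩ ⟨y, hyb, hyV⟩
          exact ⟨z, ⟨b, hb, hz⟩, hz'⟩
        · obtain ⟨z, hz, hz'⟩ := (hc ha).1 U V hU hV ⟨x, hxa, hxU⟩ ⟨y, hab hyb, hyV⟩
          exact ⟨z, ⟨a, ha, hz⟩, hz'⟩
      · exact Set.sUnion_subset fun a ha => (hc ha).2) T ⟨hT.2, hTt⟩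
  have hMne : M.Nonempty := hT.1.mono hM
  have hMc : closure M = M := by
    refine subset_antisymm ?_ subset_closure
    exact hMmax.2 ⟨hMmax.1.1.closure, closure_minimal hMmax.1.2 isClosed_closure⟩ subset_closure
  refine hM.trans (h M ⟨hMne, hMmax.1.1⟩ (hMc ▸ isClosed_closure) hMmax.1.2 ?_ ?_)
  · intro T' hT' _ hT't hMT'
    exact subset_antisymm hMT' (hMmax.2 ⟨hT'.2, hT't⟩ hMT')
  · exact fun hs => hns (hs.anti hM)

lemma easy_dir (k : Type) [Field k] (X : OverR k) (Δ : Set X.left)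
    (h : MordellicModulo k X Δ) : ArithmeticallyHyperbolicModulo k X Δ := by
  intro A hA 𝒳
  refine (h A hA 𝒳).mono' ?_
  rintro x ⟨s, hs, hx⟩
  refine ⟨Spec.map (CommRingCat.ofHom (Subring.inclusion (le_fracIn A))) ≫ s, ⟨?_, ?_⟩, ?_⟩
  · rw [Category.assoc, hs, Category.comp_id]
  · intro p _ _ _
    refine ⟨Spec.map (CommRingCat.ofHom (Subring.inclusion (le_locAt A p))) ≫ s, ?_, ?_⟩
    · rw [Category.assoc, hs, Category.comp_id]
    · rw [← Spec.map_comp_assoc]; rfl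
  · rw [← Spec.map_comp_assoc]; exact hx

lemma generic_smooth (A C : Type) [CommRing A] [CommRing C] [IsDomain A] [IsDomain C] [Algebra A C] [CharZero A]
    [IsNoetherianRing A] [Algebra.FiniteType A C] (hinj : Function.Injective (algebraMap A C)) :
    ∃ f : C, f ≠ 0 ∧ (PrimeSpectrum.basicOpen f : Set (PrimeSpectrum C)) ⊆ Algebra.smoothLocus A C := by
  have : Algebra.FinitePresentation A C := Algebra.FinitePresentation.of_finiteType.mp ‹_›
  have hmem : (⟨⊥, Ideal.isPrime_bot⟩ : PrimeSpectrum C) ∈ Algebra.smoothLocus A C := by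
    let L := Localization.AtPrime (⊥ : Ideal C)
    change Algebra.FormallySmooth A L
    have : FaithfulSMul A C := (faithfulSMul_iff_algebraMap_injective A C).mpr hinj
    have hL : IsFractionRing C L := by
      have : (⊥ : Ideal C).primeCompl = nonZeroDivisors C := by
        ext; simp [Ideal.primeCompl]
      change IsLocalization _ _
      rw [← this]; infer_instance
    let _ : Field L := hL.toField
    let K := FractionRing A
    have : FaithfulSMul A L := by
      rw [faithfulSMul_iff_algebraMap_injective, IsScalarTower.algebraMap_eq A C L]
      exact (IsFractionRing.injective C L).comp hinj
    let _ : Algebra K L := FractionRing.liftAlgebra A L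
    have : IsScalarTower A K L := FractionRing.isScalarTower_liftAlgebra A L
    have : CharZero K := charZero_of_injective_algebraMap (IsFractionRing.injective A K)
    have : Algebra.EssFiniteType C L := Algebra.EssFiniteType.of_isLocalization _ (nonZeroDivisors C)
    have : Algebra.EssFiniteType A L := Algebra.EssFiniteType.comp A C L
    have : Algebra.EssFiniteType K L := Algebra.EssFiniteType.of_comp A K L
    have : Algebra.FormallySmooth K L := inferInstance
    have : Algebra.FormallyEtale A K := Algebra.FormallyEtale.of_isLocalization (nonZeroDivisors A)
    exact Algebra.FormallySmooth.comp A K L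
  obtain ⟨_, ⟨_, ⟨f, rfl⟩, rfl⟩, h1, h2⟩ :=
    PrimeSpectrum.isBasis_basic_opens.exists_subset_of_mem_open hmem Algebra.isOpen_smoothLocus
  exact ⟨f, fun h => h1 (by simp [h]), h2⟩

lemma ft_incl {k : Type} [Field k] {A C : Subring k} (hAC : A ≤ C)
    (hC : Algebra.FiniteType ℤ C) : (Subring.inclusion hAC).FiniteType := by
  algebraize [Subring.inclusion hAC]
  have : IsScalarTower ℤ A C := inferInstance
  exact Algebra.FiniteType.of_restrictScalars_finiteType ℤ A C

lemma exists_smooth_loc {k : Type} [Field k] [CharZero k] {A C : Subring k} (hAC : A ≤ C)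
    (hA : Algebra.FiniteType ℤ A) (hC : Algebra.FiniteType ℤ C) :
    ∃ f : C, f ≠ 0 ∧ ∀ g : C, f ∣ g →
      ((algebraMap C (Localization.Away g)).comp (Subring.inclusion hAC)).Smooth := by
  have hft := ft_incl hAC hC
  algebraize [Subring.inclusion hAC]
  have : IsNoetherianRing A := Algebra.FiniteType.isNoetherianRing ℤ A
  obtain ⟨f, hf0, hf⟩ := generic_smooth A C (Subring.inclusion_injective hAC)
  have : Algebra.FinitePresentation A C := Algebra.FinitePresentation.of_finiteType.mp ‹_›
  refine ⟨f, hf0, fun g hg => ?_⟩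
  have h1 : (PrimeSpectrum.basicOpen g : Set (PrimeSpectrum C)) ⊆ Algebra.smoothLocus A C := by
    obtain ⟨c, rfl⟩ := hg
    exact (SetLike.coe_subset_coe.mpr (PrimeSpectrum.basicOpen_mul_le_left f c)).trans hf
  have h2 := Algebra.basicOpen_subset_smoothLocus_iff_smooth.mp h1
  have h3 := (RingHom.smooth_algebraMap (R := A) (S := Localization.Away g)).mpr h2
  rwa [IsScalarTower.algebraMap_eq A C] at h3

lemma exists_smooth_over {k : Type} [Field k] [CharZero k] {A B C : Subring k} (hAC : A ≤ C) (hBC : B ≤ C)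
    (hA : Algebra.FiniteType ℤ A) (hB : Algebra.FiniteType ℤ B) (hC : Algebra.FiniteType ℤ C) :
    ∃ (C' : Subring k) (h : C ≤ C'), Algebra.FiniteType ℤ C' ∧
      (Subring.inclusion (hAC.trans h)).Smooth ∧ (Subring.inclusion (hBC.trans h)).Smooth := by
  obtain ⟨f, hf0, hf⟩ := exists_smooth_loc hAC hA hC
  obtain ⟨g, hg0, hg⟩ := exists_smooth_loc hBC hB hC
  have h0 : f * g ≠ 0 := mul_ne_zero hf0 hg0
  let φ : Localization.Away (f * g) →+* k :=
    IsLocalization.Away.lift (f * g) (g := C.subtype) (by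
      rw [isUnit_iff_ne_zero]; simpa using h0)
  have hφ : φ.comp (algebraMap C _) = C.subtype := by
    ext x; simp [φ]
  have hφi : Function.Injective φ := by
    refine (IsLocalization.lift_injective_iff _).mpr fun x y => ?_
    rw [(IsLocalization.injective (Localization.Away (f*g)) (M := Submonoid.powers (f*g))
      (powers_le_nonZeroDivisors_of_noZeroDivisors h0)).eq_iff, C.subtype_injective.eq_iff]
  have hle : C ≤ φ.range := fun x hx => ⟨algebraMap C _ ⟨x, hx⟩, by
    rw [← RingHom.comp_apply, hφ]; rfl⟩
  let e : Localization.Away (f*g) ≃+* φ.range := RingEquiv.ofBijective φ.rangeRestrict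
    ⟨fun a b h => hφi (congrArg Subtype.val h), φ.rangeRestrict_surjective⟩
  have he : e.toRingHom.comp (algebraMap C _) = Subring.inclusion hle := by
    ext x
    exact congrArg (fun f => f x) hφ
  refine ⟨φ.range, hle, ?_, ?_, ?_⟩
  · have : Algebra.FiniteType C (Localization.Away (f*g)) :=
      IsLocalization.finiteType_of_monoid_fg (Submonoid.powers (f*g)) _
    have : Algebra.FiniteType ℤ (Localization.Away (f*g)) := Algebra.FiniteType.trans hC this
    exact this.equiv (AlgEquiv.ofRingEquiv (f := e) fun n => by simp)
  · have := RingHom.Smooth.respectsIso.1 _ e (hf (f*g) (dvd_mul_right _ _))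
    rw [← RingHom.comp_assoc, he] at this
    exact this
  · have := RingHom.Smooth.respectsIso.1 _ e (hg (f*g) (dvd_mul_left _ _))
    rw [← RingHom.comp_assoc, he] at this
    exact this

/-- elements of locAt -/
lemma mem_locAt {k : Type} [Field k] {A : Subring k} (p : Ideal A) [p.IsPrime] {x : k} (hx : x ∈ locAt A p) :
    ∃ a s : A, s ∉ p ∧ x * s = a := by
  induction hx using Subring.closure_induction with
  | mem x hx =>
    rcases hx with hx | ⟨s, hs, _, h⟩
    · exact ⟨⟨x, hx⟩, 1, p.one_notMem, by simp⟩
    · exact ⟨1, s, hs, by simpa using h⟩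
  | zero => exact ⟨0, 1, p.one_notMem, by simp⟩
  | one => exact ⟨1, 1, p.one_notMem, by simp⟩
  | add x y _ _ hx hy =>
    obtain ⟨a, s, hs, h⟩ := hx
    obtain ⟨b, t, ht, h'⟩ := hy
    refine ⟨a * t + b * s, s * t, fun h => (Ideal.IsPrime.mem_or_mem ‹_› h).elim hs ht, ?_⟩
    push_cast; rw [← h, ← h']; ring
  | neg x _ hx =>
    obtain ⟨a, s, hs, h⟩ := hx
    exact ⟨-a, s, hs, by push_cast; rw [← h]; ring⟩
  | mul x y _ _ hx hy =>
    obtain ⟨a, s, hs, h⟩ := hx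
    obtain ⟨b, t, ht, h'⟩ := hy
    refine ⟨a * b, s * t, fun h => (Ideal.IsPrime.mem_or_mem ‹_› h).elim hs ht, ?_⟩
    push_cast; rw [← h, ← h']; ring

lemma isLoc_locAt {k : Type} [Field k] {A : Subring k} (p : Ideal A) [p.IsPrime] :
    @IsLocalization _ _ p.primeCompl (locAt A p) _ (Subring.inclusion (le_locAt A p)).toAlgebra := by
  let _ := (Subring.inclusion (le_locAt A p)).toAlgebra
  have hne : ∀ s : A, s ∉ p → (s : k) ≠ 0 := fun s hs h => hs (by
    have : s = 0 := Subtype.ext h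
    simp [this])
  refine ⟨?_, ?_, ?_⟩
  · rintro ⟨s, hs⟩
    have h0 := hne s hs
    refine IsUnit.of_mul_eq_one (⟨(s : k)⁻¹, Subring.subset_closure (Or.inr ⟨s, hs, h0, inv_mul_cancel₀ h0⟩)⟩ : locAt A p) ?_
    exact Subtype.ext (mul_inv_cancel₀ h0)
  · rintro ⟨x, hx⟩
    obtain ⟨a, s, hs, h⟩ := mem_locAt p hx
    exact ⟨⟨a, ⟨s, hs⟩⟩, Subtype.ext h⟩
  · intro x y h
    refine ⟨1, ?_⟩
    rw [Subring.inclusion_injective (le_locAt A p) h]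

lemma locAt_mono {k : Type} [Field k] {A C : Subring k} (h : A ≤ C) (q : Ideal C) :
    locAt A (q.comap (Subring.inclusion h)) ≤ locAt C q := by
  refine Subring.closure_mono (Set.union_subset_union h ?_)
  rintro x ⟨s, hs, h0, hx⟩
  exact ⟨Subring.inclusion h s, hs, h0, hx⟩

lemma fracIn_le_locAt {k : Type} [Field k] {A C : Subring k} (h : A ≤ C) (q : Ideal C)
    (hq : q.comap (Subring.inclusion h) = ⊥) :
    fracIn A ≤ locAt C q := by
  refine Subring.closure_mono (Set.union_subset_union h ?_)
  rintro x ⟨s, h0, hx⟩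
  refine ⟨Subring.inclusion h s, fun hs => ?_, h0, hx⟩
  have : s ∈ q.comap (Subring.inclusion h) := hs
  rw [hq] at this
  apply h0
  rw [(Ideal.mem_bot.mp this)]; rfl

lemma comap_height {k : Type} [Field k] {A C : Subring k} (h : A ≤ C)
    (hs : (Subring.inclusion h).Smooth) (q : Ideal C) [q.IsPrime]
    (hq : ∀ q' : Ideal C, q'.IsPrime → q' < q → q' = ⊥) (p : Ideal A) [p.IsPrime]
    (hp : p < q.comap (Subring.inclusion h)) : p = ⊥ := by
  algebraize [Subring.inclusion h]
  have : (q.comap (Subring.inclusion h)).IsPrime := inferInstance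
  have : q.LiesOver (q.comap (Subring.inclusion h)) := ⟨rfl⟩
  obtain ⟨P, hP, hP1, hP2⟩ := Ideal.exists_ideal_lt_liesOver_of_lt q hp
  have := hq P hP1 hP
  subst this
  rw [hP2.over]
  exact (RingHom.injective_iff_ker_eq_bot _).mp (Subring.inclusion_injective h)

lemma ft_iff_fg {k : Type} [Field k] (C : Subring k) :
    Algebra.FiniteType ℤ C ↔ (subalgebraOfSubring C).FG := by
  rw [Subalgebra.fg_iff_finiteType]; rfl

lemma ft_sup {k : Type} [Field k] {C D : Subring k} (hC : Algebra.FiniteType ℤ C)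
    (hD : Algebra.FiniteType ℤ D) : Algebra.FiniteType ℤ ↥(C ⊔ D) := by
  rw [ft_iff_fg] at *
  obtain ⟨s, hs⟩ := hC
  obtain ⟨t, ht⟩ := hD
  have h : ∀ (s : Finset k) (C : Subring k), Algebra.adjoin ℤ (s : Set k) = subalgebraOfSubring C → Subring.closure (s : Set k) = C := by
    intro s C h
    rw [Algebra.adjoin_int] at h
    ext x
    exact SetLike.ext_iff.mp h x
  classical
  refine ⟨s ∪ t, ?_⟩
  rw [Algebra.adjoin_int, Finset.coe_union, Subring.closure_union, h _ _ hs, h _ _ ht]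

lemma ft_closure_singleton {k : Type} [Field k] (x : k) :
    Algebra.FiniteType ℤ ↥(Subring.closure {x}) := by
  rw [ft_iff_fg]
  exact ⟨{x}, by rw [Algebra.adjoin_int]; simp⟩

/-- index set -/
abbrev SIdx {k : Type} [Field k] (D : Subring k) : Type :=
  {C : Subring k // D ≤ C ∧ Algebra.FiniteType ℤ C}

instance {k : Type} [Field k] (D : Subring k) : IsDirectedOrder (SIdx D) :=
  ⟨fun C C' => ⟨⟨C.1 ⊔ C'.1, C.2.1.trans le_sup_left, ft_sup C.2.2 C'.2.2⟩,
    Subtype.coe_le_coe.mp le_sup_left, Subtype.coe_le_coe.mp le_sup_right⟩⟩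

def ringF {k : Type} [Field k] (D : Subring k) : SIdx D ⥤ CommRingCat.{0} where
  obj C := CommRingCat.of C.1
  map f := CommRingCat.ofHom (Subring.inclusion (leOfHom f))

def ringCocone {k : Type} [Field k] (D : Subring k) : Cocone (ringF D) where
  pt := CommRingCat.of k
  ι := { app := fun C => CommRingCat.ofHom C.1.subtype }

def ringColim {k : Type} [Field k] (D : Subring k) (hD : Algebra.FiniteType ℤ D) :
    IsColimit (ringCocone D) := by
  have : Nonempty (SIdx D) := ⟨⟨D, le_rfl, hD⟩⟩
  have : IsFiltered (SIdx D) := inferInstance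
  have : ReflectsFilteredColimits (forget CommRingCat.{0}) :=
    ⟨fun _ => reflectsColimitsOfShape_of_reflectsIsomorphisms⟩
  refine isColimitOfReflects (forget CommRingCat) ?_
  refine Types.FilteredColimit.isColimitOf' _ _ ?_ ?_
  · intro (x : k)
    refine ⟨⟨D ⊔ Subring.closure {x}, le_sup_left, ft_sup hD (ft_closure_singleton x)⟩,
      ⟨x, (le_sup_right : _ ≤ D ⊔ Subring.closure {x}) (Subring.subset_closure rfl)⟩, rfl⟩
  · intro C x y h
    refine ⟨C, 𝟙 C, ?_⟩
    have : x = y := Subtype.ext h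
    rw [this]

/-- Spec of the inclusion -/
abbrev sI {k : Type} [Field k] {A C : Subring k} (h : A ≤ C) : SR C ⟶ SR A :=
  Spec.map (CommRingCat.ofHom (Subring.inclusion h))
abbrev sK {k : Type} [Field k] (A : Subring k) : SR k ⟶ SR A :=
  Spec.map (CommRingCat.ofHom A.subtype)

lemma sI_sI {k : Type} [Field k] {A C D : Subring k} (h : A ≤ C) (h' : C ≤ D) :
    sI h' ≫ sI h = sI (h.trans h') := by
  rw [← Spec.map_comp]; rfl
lemma sK_sI {k : Type} [Field k] {A C : Subring k} (h : A ≤ C) :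
    sK C ≫ sI h = sK A := by
  rw [← Spec.map_comp]; rfl

lemma sI_sI_assoc {k : Type} [Field k] {A C D : Subring k} (h : A ≤ C) (h' : C ≤ D)
    {Z : Scheme.{0}} (z : SR A ⟶ Z) : sI h' ≫ sI h ≫ z = sI (h.trans h') ≫ z := by
  rw [← Category.assoc, sI_sI]
lemma sK_sI_assoc {k : Type} [Field k] {A C : Subring k} (h : A ≤ C)
    {Z : Scheme.{0}} (z : SR A ⟶ Z) : sK C ≫ sI h ≫ z = sK A ≫ z := by
  rw [← Category.assoc, sK_sI]

def specCone {k : Type} [Field k] (D : Subring k) : Cone ((ringF D).op ⋙ Scheme.Spec) :=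
  Scheme.Spec.mapCone (ringCocone D).op

def specLim {k : Type} [Field k] (D : Subring k) (hD : Algebra.FiniteType ℤ D) :
    IsLimit (specCone D) := isLimitOfPreserves Scheme.Spec (ringColim D hD).op

section
variable {k : Type} [Field k] {A : Subring k} {M : Scheme.{0}} (m : M ⟶ SR A)

def bcMap {C C' : Subring k} (h : A ≤ C) (h' : C ≤ C') (h'' : A ≤ C') :
    pullback m (sI h'') ⟶ pullback m (sI h) :=
  pullback.lift (pullback.fst _ _) (pullback.snd _ _ ≫ sI h') (by
    rw [pullback.condition, Category.assoc, sI_sI])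

def bcMapK {C : Subring k} (h : A ≤ C) :
    pullback m (sK A) ⟶ pullback m (sI h) :=
  pullback.lift (pullback.fst _ _) (pullback.snd _ _ ≫ sK C) (by
    rw [pullback.condition, Category.assoc, sK_sI])

lemma bcMap_fst {C C' : Subring k} (h : A ≤ C) (h' : C ≤ C') (h'' : A ≤ C') :
    bcMap m h h' h'' ≫ pullback.fst _ _ = pullback.fst _ _ := pullback.lift_fst _ _ _
lemma bcMap_snd {C C' : Subring k} (h : A ≤ C) (h' : C ≤ C') (h'' : A ≤ C') :
    bcMap m h h' h'' ≫ pullback.snd _ _ = pullback.snd _ _ ≫ sI h' := pullback.lift_snd _ _ _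
lemma bcMapK_fst {C : Subring k} (h : A ≤ C) :
    bcMapK m h ≫ pullback.fst _ _ = pullback.fst _ _ := pullback.lift_fst _ _ _
lemma bcMapK_snd {C : Subring k} (h : A ≤ C) :
    bcMapK m h ≫ pullback.snd _ _ = pullback.snd _ _ ≫ sK C := pullback.lift_snd _ _ _

lemma bcMap_snd_assoc {C C' : Subring k} (h : A ≤ C) (h' : C ≤ C') (h'' : A ≤ C')
    {Z : Scheme.{0}} (z : SR C ⟶ Z) :
    bcMap m h h' h'' ≫ pullback.snd _ _ ≫ z = pullback.snd _ _ ≫ sI h' ≫ z := by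
  rw [← Category.assoc, bcMap_snd, Category.assoc]
lemma bcMapK_fst_assoc {C : Subring k} (h : A ≤ C) {Z : Scheme.{0}} (z : M ⟶ Z) :
    bcMapK m h ≫ pullback.fst _ _ ≫ z = pullback.fst _ _ ≫ z := by
  rw [← Category.assoc, bcMapK_fst]
lemma bcMapK_snd_assoc {C : Subring k} (h : A ≤ C) {Z : Scheme.{0}} (z : SR C ⟶ Z) :
    bcMapK m h ≫ pullback.snd _ _ ≫ z = pullback.snd _ _ ≫ sK C ≫ z := by
  rw [← Category.assoc, bcMapK_snd, Category.assoc]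

lemma compact_bc [QuasiCompact m] {C : Subring k} (h : A ≤ C) :
    CompactSpace ↥(pullback m (sI h)) := by
  have : QuasiCompact (pullback.snd m (sI h)) := inferInstance
  exact QuasiCompact.compactSpace_of_compactSpace (pullback.snd m (sI h))
lemma qs_bc [IsSeparated m] {C : Subring k} (h : A ≤ C) :
    QuasiSeparatedSpace ↥(pullback m (sI h)) := by
  have : IsSeparated (pullback.snd m (sI h)) := inferInstance
  exact quasiSeparatedSpace_of_quasiSeparated (pullback.snd m (sI h))

lemma isPullback_bcMap {C C' : Subring k} (h : A ≤ C) (h' : C ≤ C') (h'' : A ≤ C') :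
    IsPullback (bcMap m h h' h'') (pullback.snd _ _) (pullback.snd _ _) (sI h') := by
  refine IsPullback.of_right (h₁₂ := pullback.fst _ _) (h₂₂ := sI h) (v₁₃ := m) ?_ (bcMap_snd m h h' h'')
    (IsPullback.of_hasPullback _ _)
  rw [bcMap_fst, sI_sI]
  exact IsPullback.of_hasPullback _ _

lemma isPullback_bcMapK {C : Subring k} (h : A ≤ C) :
    IsPullback (bcMapK m h) (pullback.snd _ _) (pullback.snd _ _) (sK C) := by
  refine IsPullback.of_right (h₁₂ := pullback.fst _ _) (h₂₂ := sI h) (v₁₃ := m) ?_ (bcMapK_snd m h)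
    (IsPullback.of_hasPullback _ _)
  rw [bcMapK_fst, sK_sI]
  exact IsPullback.of_hasPullback _ _

variable {D : Subring k} (h : A ≤ D)

def pbF : (SIdx D)ᵒᵖ ⥤ Scheme.{0} where
  obj C := pullback m (sI (h.trans C.unop.2.1))
  map {C C'} f := bcMap m _ (leOfHom f.unop) _
  map_id C := by
    apply pullback.hom_ext
    · rw [bcMap_fst, Category.id_comp]
    · rw [bcMap_snd, Category.id_comp]
      exact (congrArg (pullback.snd m (sI (h.trans C.unop.2.1)) ≫ ·) (Spec.map_id _)).trans (Category.comp_id _)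
  map_comp f g := by
    apply pullback.hom_ext
    · rw [bcMap_fst, Category.assoc, bcMap_fst, bcMap_fst]
    · rw [bcMap_snd, Category.assoc, bcMap_snd, bcMap_snd_assoc, sI_sI]

def pbα : pbF m h ⟶ (ringF D).op ⋙ Scheme.Spec where
  app C := pullback.snd _ _
  naturality C C' f := bcMap_snd m _ (leOfHom f.unop) _

def pbCone : Cone (pbF m h) where
  pt := pullback m (sK A)
  π := { 
    app C := bcMapK m _
    naturality C C' f := by
      change 𝟙 _ ≫ bcMapK m _ = bcMapK m _ ≫ bcMap m _ (leOfHom f.unop) _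
      rw [Category.id_comp]
      apply pullback.hom_ext
      · rw [bcMapK_fst, Category.assoc, bcMap_fst, bcMapK_fst]
      · rw [bcMapK_snd, Category.assoc, bcMap_snd, bcMapK_snd_assoc, sK_sI] }

def pbConeHom : (Cone.postcompose (pbα m h)).obj (pbCone m h) ⟶ specCone D where
  hom := pullback.snd m (sK A)
  w C := (bcMapK_snd m (h.trans C.unop.2.1)).symm

def pbLim (hD : Algebra.FiniteType ℤ D) : IsLimit (pbCone m h) := by
  have : Nonempty (SIdx D) := ⟨⟨D, le_rfl, hD⟩⟩
  have : IsCofiltered (SIdx D)ᵒᵖ := inferInstance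
  have : CategoryTheory.IsConnected (SIdx D)ᵒᵖ := IsCofiltered.isConnected _
  exact isLimitOfIsPullbackOfIsConnected (pbα m h) _ _ (pbConeHom m h)
    (fun C => isPullback_bcMapK m (h.trans C.unop.2.1)) (specLim D hD)

lemma spread_hom {B : Subring k} (hB : B ≤ D) (hD : Algebra.FiniteType ℤ D)
    [QuasiCompact m] [IsSeparated m] {N : Scheme.{0}} (n : N ⟶ SR B) [LocallyOfFinitePresentation n]
    (a : pullback m (sK A) ⟶ N) (ha : a ≫ n = pullback.snd _ _ ≫ sK B) :
    ∃ (C : Subring k) (hDC : D ≤ C) (_ : Algebra.FiniteType ℤ C) (g : pullback m (sI (h.trans hDC)) ⟶ N),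
      g ≫ n = pullback.snd _ _ ≫ sI (hB.trans hDC) ∧ bcMapK m (h.trans hDC) ≫ g = a := by
  have : Nonempty (SIdx D) := ⟨⟨D, le_rfl, hD⟩⟩
  have : IsCofiltered (SIdx D)ᵒᵖ := inferInstance
  let t : pbF m h ⟶ (Functor.const _).obj (SR B) :=
    { app C := pullback.snd _ _ ≫ sI (hB.trans C.unop.2.1)
      naturality C C' f := by
        refine (bcMap_snd_assoc m _ (leOfHom f.unop) _ _).trans ?_
        rw [sI_sI]
        exact (Category.comp_id _).symm }
  have hsnd : ∀ {C C' : (SIdx D)ᵒᵖ} (f : C ⟶ C'), IsAffineHom ((pbF m h).map f) := fun f =>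
    MorphismProperty.of_isPullback (P := @IsAffineHom) (isPullback_bcMap m _ (leOfHom f.unop) _).flip
      inferInstance
  have hc : ∀ C, CompactSpace ((pbF m h).obj C) := fun C =>
    compact_bc m (h.trans C.unop.2.1)
  have hq : ∀ C, QuasiSeparatedSpace ((pbF m h).obj C) := fun C =>
    qs_bc m (h.trans C.unop.2.1)
  obtain ⟨C, g, h1, h2⟩ := Scheme.exists_π_app_comp_eq_of_locallyOfFinitePresentation (pbF m h) t n (pbCone m h)
    (pbLim m h hD) a (by
      ext C : 2
      change bcMapK m _ ≫ pullback.snd _ _ ≫ _ = a ≫ n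
      refine (bcMapK_snd_assoc m _ _).trans ?_
      rw [sK_sI, ha])
  exact ⟨C.unop.1, C.unop.2.1, C.unop.2.2, g, h2, h1⟩
end

/-- the prime ideal of a point of `Spec C` -/
def pid {k : Type} [Field k] {C : Subring k} (x : ↥(SR C)) : Ideal C := PrimeSpectrum.asIdeal (R := C) x

lemma exists_stalk {k : Type} [Field k] (C : Subring k) (x : ↥(SR C)) :
    ∃ e : CommRingCat.of (locAt C (pid x)) ≅ (SR C).presheaf.stalk x,
      Spec.map e.hom ≫ sI (le_locAt C (pid x)) = (SR C).fromSpecStalk x := by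
  let _ := (Subring.inclusion (le_locAt C (pid x))).toAlgebra
  have hp : (pid x).IsPrime := PrimeSpectrum.isPrime (R := C) x
  have h1 : IsLocalization (pid x).primeCompl (locAt C (pid x)) := isLoc_locAt (pid x)
  let x' : PrimeSpectrum C := x
  have h2 : IsLocalization (pid x).primeCompl ((Spec.structureSheaf C).presheaf.stalk x') :=
    (inferInstance : IsLocalization.AtPrime ((Spec.structureSheaf C).presheaf.stalk x') x'.asIdeal)
  let e : locAt C (pid x) ≃ₐ[C] (Spec.structureSheaf C).presheaf.stalk x' :=
    IsLocalization.algEquiv (pid x).primeCompl _ _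
  let e' : CommRingCat.of (locAt C (pid x)) ≅ (SR C).presheaf.stalk x := e.toRingEquiv.toCommRingCatIso
  refine ⟨e', ?_⟩
  rw [Spec.fromSpecStalk_eq', ← Spec.map_comp]
  refine congrArg Spec.map ?_
  refine CommRingCat.hom_ext (RingHom.ext fun a => ?_)
  exact e.commutes a

lemma spread_pt {k : Type} [Field k] {B C : Subring k} (hB : B ≤ C) {N : Scheme.{0}} (n : N ⟶ SR B)
    [LocallyOfFiniteType n] (x : ↥(SR C)) (φ : SR (locAt C (pid x)) ⟶ N)
    (hφ : φ ≫ n = sI (hB.trans (le_locAt C (pid x)))) :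
    ∃ (U : (SR C).Opens) (_ : x ∈ U) (f : U.toScheme ⟶ N), f ≫ n = U.ι ≫ sI hB ∧
      ∀ j : SR k ⟶ U.toScheme, j ≫ U.ι = sK C → j ≫ f = sK _ ≫ φ := by
  obtain ⟨e, he⟩ := exists_stalk C x
  have hIntC : IsIntegral (SR C) := inferInstance
  obtain ⟨U, hxU, f, h1, h2⟩ := spread_out_of_isGermInjective' (sI hB) n (X := SR C) (x := x)
    (Spec.map e.hom ≫ φ) (by rw [Category.assoc, hφ, ← sI_sI hB (le_locAt C (pid x)), ← he, Category.assoc])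
  refine ⟨U, hxU, f, h2, fun j hj => ?_⟩
  have : j = sK _ ≫ Spec.map e.inv ≫ U.fromSpecStalkOfMem x hxU := by
    rw [← cancel_mono U.ι, hj, Category.assoc, Category.assoc, Scheme.Opens.fromSpecStalkOfMem_ι, ← he,
      ← Category.assoc (Spec.map e.inv), ← Spec.map_comp, e.hom_inv_id, Spec.map_id, Category.id_comp, sK_sI]
  rw [this, Category.assoc, Category.assoc, ← h1, ← Category.assoc (Spec.map e.inv), ← Spec.map_comp,
    e.hom_inv_id, Spec.map_id, Category.id_comp]

lemma sK_specPt {k : Type} [Field k] (C : Subring k) (z : SR k) :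
    (sK C) z = (⟨⊥, Ideal.isPrime_bot⟩ : PrimeSpectrum C) := by
  have hz : z = (⟨⊥, Ideal.isPrime_bot⟩ : PrimeSpectrum k) := Subsingleton.elim (α := PrimeSpectrum k) _ _
  subst hz
  apply PrimeSpectrum.ext
  ext a
  change (C.subtype a ∈ (⊥ : Ideal k)) ↔ a ∈ (⊥ : Ideal C)
  simp

lemma bot_mem_open {k : Type} [Field k] {C : Subring k} (U : (SR C).Opens) (x : PrimeSpectrum C) (hx : x ∈ U) :
    (⟨⊥, Ideal.isPrime_bot⟩ : PrimeSpectrum C) ∈ U := by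
  have : (⟨⊥, Ideal.isPrime_bot⟩ : PrimeSpectrum C) ⤳ x := by
    rw [← PrimeSpectrum.le_iff_specializes]
    exact (bot_le : ⊥ ≤ x.asIdeal)
  exact this.mem_open U.2 hx

def kpt {k : Type} [Field k] {C : Subring k} (U : (SR C).Opens) (x : PrimeSpectrum C) (hx : x ∈ U) :
    SR k ⟶ U.toScheme := IsOpenImmersion.lift U.ι (sK C) (by
      rintro _ ⟨z, rfl⟩
      rw [sK_specPt, Scheme.Opens.range_ι]
      exact bot_mem_open U x hx)

lemma kpt_ι {k : Type} [Field k] {C : Subring k} (U : (SR C).Opens) (x : PrimeSpectrum C) (hx : x ∈ U) :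
    kpt U x hx ≫ U.ι = sK C := IsOpenImmersion.lift_fac _ _ _

lemma dominant_pt {k : Type} [Field k] {C : Subring k} (U : (SR C).Opens)
    (j : SR k ⟶ U.toScheme) (hj : j ≫ U.ι = sK C) : IsDominant j := by
  refine ⟨fun u => ?_⟩
  rw [mem_closure_iff]
  intro V hV hu
  refine ⟨j (specPt k), ?_, ⟨_, rfl⟩⟩
  have h1 : U.ι (j (specPt k)) = (⟨⊥, Ideal.isPrime_bot⟩ : PrimeSpectrum C) := by
    rw [← Scheme.Hom.comp_apply, hj, sK_specPt]
  have h2 : j (specPt k) ⤳ u := by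
    rw [← U.ι.isOpenEmbedding.isInducing.specializes_iff, h1]
    exact (PrimeSpectrum.le_iff_specializes _ _).mp
      (bot_le : ⊥ ≤ PrimeSpectrum.asIdeal (R := C) (U.ι u))
  exact h2.mem_open hV hu

lemma glue_pt {k : Type} [Field k] {B C : Subring k} (hB : B ≤ C) {N : Scheme.{0}} (n : N ⟶ SR B)
    [IsSeparated n] {J : Type} [Nonempty J] (U : J → (SR C).Opens) (x : J → PrimeSpectrum C) (hx : ∀ i, x i ∈ U i)
    (f : ∀ i, (U i).toScheme ⟶ N) (hf : ∀ i, f i ≫ n = (U i).ι ≫ sI hB) (y : SR k ⟶ N)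
    (hy : ∀ i, ∀ j : SR k ⟶ (U i).toScheme, j ≫ (U i).ι = sK C → j ≫ f i = y) :
    ∃ g : (⨆ i, U i).toScheme ⟶ N, g ≫ n = (⨆ i, U i).ι ≫ sI hB ∧
      ∀ j : SR k ⟶ (⨆ i, U i).toScheme, j ≫ (⨆ i, U i).ι = sK C → j ≫ g = y := by
  let 𝒰 := Scheme.Opens.iSupOpenCover U
  have key : ∀ i i' : J, (SR C).homOfLE (inf_le_left : U i ⊓ U i' ≤ U i) ≫ f i =
      (SR C).homOfLE (inf_le_right : U i ⊓ U i' ≤ U i') ≫ f i' := by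
    intro i i'
    have hb : (⟨⊥, Ideal.isPrime_bot⟩ : PrimeSpectrum C) ∈ U i ⊓ U i' :=
      ⟨bot_mem_open _ _ (hx i), bot_mem_open _ _ (hx i')⟩
    let j := kpt (U i ⊓ U i') _ hb
    have hj := kpt_ι (U i ⊓ U i') _ hb
    have : IsDominant j := dominant_pt _ j hj
    refine ext_of_isDominant_of_isSeparated n ?_ j ?_
    · rw [Category.assoc, Category.assoc, hf, hf, Scheme.homOfLE_ι_assoc, Scheme.homOfLE_ι_assoc]
    · rw [← Category.assoc, ← Category.assoc, hy i, hy i']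
      · rw [Category.assoc, Scheme.homOfLE_ι]; exact hj
      · rw [Category.assoc, Scheme.homOfLE_ι]; exact hj
  have hcompat : ∀ i i' : J, pullback.fst ((SR C).homOfLE (le_iSup U i)) ((SR C).homOfLE (le_iSup U i')) ≫ f i =
      pullback.snd _ _ ≫ f i' := by
    intro i i'
    rw [← cancel_epi (isPullback_opens_inf_le (le_iSup U i) (le_iSup U i')).isoPullback.hom]
    rw [IsPullback.isoPullback_hom_fst_assoc, IsPullback.isoPullback_hom_snd_assoc, key]
  let g : (⨆ i, U i).toScheme ⟶ N := 𝒰.glueMorphisms f hcompat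
  have hg : ∀ i : J, (SR C).homOfLE (le_iSup U i) ≫ g = f i := 𝒰.ι_glueMorphisms f hcompat
  refine ⟨g, ?_, ?_⟩
  · refine 𝒰.hom_ext _ _ fun i => ?_
    have : ∀ i : J, (SR C).homOfLE (le_iSup U i) ≫ g ≫ n = (SR C).homOfLE (le_iSup U i) ≫ (⨆ i, U i).ι ≫ sI hB := by
      intro i
      rw [← Category.assoc, hg, Scheme.homOfLE_ι_assoc, hf]
    exact this i
  · intro j hj
    obtain ⟨i⟩ := ‹Nonempty J›
    have : j = kpt (U i) _ (hx i) ≫ (SR C).homOfLE (le_iSup U i) := by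
      rw [← cancel_mono (⨆ i, U i).ι, hj, Category.assoc, Scheme.homOfLE_ι, kpt_ι]
    rw [this, Category.assoc, hg]
    exact hy i _ (kpt_ι _ _ _)

lemma big_open {k : Type} [Field k] {B C : Subring k} (hB : B ≤ C) {N : Scheme.{0}} (n : N ⟶ SR B)
    [IsSeparated n] [LocallyOfFiniteType n] (y : SR k ⟶ N)
    (H : ∀ q : Ideal C, q.IsPrime → (∀ q' : Ideal C, q'.IsPrime → q' < q → q' = ⊥) →
      ∃ φ : SR (locAt C q) ⟶ N, φ ≫ n = sI (hB.trans (le_locAt C q)) ∧ sK _ ≫ φ = y) :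
    ∃ (U : (SR C).Opens), Dense (U : Set (SR C)) ∧ CodimAtLeastTwo ((U : Set (SR C))ᶜ) ∧
      ∃ g : U.toScheme ⟶ N, g ≫ n = U.ι ≫ sI hB ∧ ∃ j : SR k ⟶ U.toScheme, j ≫ U.ι = sK C ∧ j ≫ g = y := by
  let J := {x : PrimeSpectrum C // ∀ q' : Ideal C, q'.IsPrime → q' < x.asIdeal → q' = ⊥}
  have : Nonempty J := ⟨⟨⟨⊥, Ideal.isPrime_bot⟩, fun q' _ h => (not_lt_bot h).elim⟩⟩
  choose φ h1 h2 using fun x : J => H x.1.asIdeal x.1.2 x.2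
  choose U hx f hf hj using fun x : J => spread_pt hB n x.1 (φ x) (h1 x)
  obtain ⟨g, hg, hgj⟩ := glue_pt hB n U (fun x => x.1) hx f hf y (fun x j h => (hj x j h).trans (h2 x))
  have hmem : ∀ x : J, x.1 ∈ ⨆ x, U x := fun x => TopologicalSpace.Opens.mem_iSup.mpr ⟨x, hx x⟩
  obtain ⟨x0⟩ := this
  refine ⟨⨆ x, U x, ?_, ?_, g, hg, kpt _ _ (hmem x0), kpt_ι _ _ _, hgj _ (kpt_ι _ _ _)⟩
  · exact (⨆ x, U x).2.dense ⟨x0.1, hmem x0⟩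
  · intro (z : PrimeSpectrum C) hz
    have : ¬ ∀ q' : Ideal C, q'.IsPrime → q' < z.asIdeal → q' = ⊥ := fun h => hz (hmem ⟨z, h⟩)
    push Not at this
    obtain ⟨q', hq', hlt, hne⟩ := this
    refine ⟨(⟨⊥, Ideal.isPrime_bot⟩ : PrimeSpectrum C), (⟨q', hq'⟩ : PrimeSpectrum C), ?_, ?_, ?_, ?_⟩
    · exact (PrimeSpectrum.le_iff_specializes _ _).mp (bot_le : (⊥ : Ideal C) ≤ q')
    · exact (PrimeSpectrum.le_iff_specializes _ _).mp hlt.le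
    · intro h
      exact hne (le_bot_iff.mp ((PrimeSpectrum.le_iff_specializes _ _).mpr h : q' ≤ ⊥))
    · intro h
      exact hlt.not_ge ((PrimeSpectrum.le_iff_specializes _ _).mpr h : z.asIdeal ≤ q')

lemma SchemeModel.base_inv_snd {k : Type} [Field k] {A : Subring k} {X : OverR k} (𝒳 : SchemeModel k A X) :
    𝒳.base.inv ≫ pullback.snd 𝒳.str (sK A) = X.hom := by
  rw [Iso.inv_comp_eq]; exact 𝒳.base_w.symm

/-- base change of a model -/
def SchemeModel.bc {k : Type} [Field k] {B C : Subring k} {X : OverR k} (𝒴 : SchemeModel k B X) (h : B ≤ C) :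
    SchemeModel k C X where
  M := pullback 𝒴.str (sI h)
  str := pullback.snd _ _
  lft := have := 𝒴.lft; inferInstance
  qc := have := 𝒴.qc; inferInstance
  sep := have := 𝒴.sep; inferInstance
  base := (isPullback_bcMapK 𝒴.str h).isoPullback.symm ≪≫ 𝒴.base
  base_w := by
    rw [Iso.trans_hom, Category.assoc, 𝒴.base_w, Iso.symm_hom, IsPullback.isoPullback_inv_snd]

lemma smooth_sI {k : Type} [Field k] {B C : Subring k} (h : B ≤ C) (hs : (Subring.inclusion h).Smooth) :
    IsSmooth (sI h) := by
  exact (HasRingHomProperty.Spec_iff (P := @Smooth)).mpr hs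

lemma lfp_model {k : Type} [Field k] {B : Subring k} (hB : Algebra.FiniteType ℤ B) {X : OverR k}
    (𝒴 : SchemeModel k B X) : LocallyOfFinitePresentation 𝒴.str := by
  have : IsNoetherianRing B := Algebra.FiniteType.isNoetherianRing ℤ B
  have : IsNoetherianRing (CommRingCat.of B) := this
  have : IsLocallyNoetherian (SR B) := inferInstance
  have := 𝒴.lft
  infer_instance

lemma phi_exists {k : Type} [Field k] {A C : Subring k} (h : A ≤ C) (hs : (Subring.inclusion h).Smooth)
    {X : OverR k} (𝒳 : SchemeModel k A X) (P : SR (fracIn A) ⟶ 𝒳.M) (hP : 𝒳.IsNearIntegralPoint P)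
    (q : Ideal C) [q.IsPrime] (hq : ∀ q' : Ideal C, q'.IsPrime → q' < q → q' = ⊥) :
    ∃ φ : SR (locAt C q) ⟶ 𝒳.M, φ ≫ 𝒳.str = sI (h.trans (le_locAt C q)) ∧ sK _ ≫ φ = sK _ ≫ P := by
  by_cases h0 : q.comap (Subring.inclusion h) = ⊥
  · refine ⟨sI (fracIn_le_locAt h q h0) ≫ P, ?_, ?_⟩
    · rw [Category.assoc, hP.1]
      exact sI_sI _ _
    · exact sK_sI_assoc _ _
  · obtain ⟨Q, hQ1, hQ2⟩ := hP.2 (q.comap (Subring.inclusion h)) inferInstance h0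
      (fun p hp hlt => @comap_height k _ A C h hs q _ hq p hp hlt)
    refine ⟨sI (locAt_mono h q) ≫ Q, ?_, ?_⟩
    · rw [Category.assoc, hQ1]
      exact sI_sI _ _
    · rw [← hQ2]
      exact (sK_sI_assoc _ _).trans (sK_sI_assoc _ _).symm

lemma hard_dir (k : Type) [Field k] [CharZero k] (X : OverR k) (Δ : Set X.left)
    (hpure : HasArithmeticallyPureModel k X)
    (H : ArithmeticallyHyperbolicModulo k X Δ) : MordellicModulo k X Δ := by
  intro A hA 𝒳
  obtain ⟨B, hBft, 𝒴, hY⟩ := hpure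
  have := 𝒳.lft; have := 𝒳.qc; have := 𝒳.sep
  have := 𝒴.lft; have := 𝒴.qc; have := 𝒴.sep
  have := lfp_model hBft 𝒴
  obtain ⟨C1, hDC1, hC1, g, hg1, hg2⟩ := spread_hom 𝒳.str (le_sup_left : A ≤ A ⊔ B) le_sup_right
    (ft_sup hA hBft) 𝒴.str (𝒳.base.hom ≫ 𝒴.base.inv ≫ pullback.fst 𝒴.str (sK B)) (by
      rw [Category.assoc, Category.assoc, pullback.condition, ← Category.assoc 𝒴.base.inv,
        𝒴.base_inv_snd, ← Category.assoc, 𝒳.base_w])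
  have hAC1 : A ≤ C1 := le_sup_left.trans hDC1
  have hBC1 : B ≤ C1 := le_sup_right.trans hDC1
  obtain ⟨C, hC1C, hC, hsA, hsB⟩ := exists_smooth_over hAC1 hBC1 hA hBft hC1
  have hAC : A ≤ C := hAC1.trans hC1C
  have hBC : B ≤ C := hBC1.trans hC1C
  refine (H C hC (𝒴.bc hBC)).mono' ?_
  rintro x ⟨P, hP, q, hq1, hq2, hx⟩
  have hqX : q ≫ X.hom = 𝟙 _ := by
    rw [← 𝒳.base_inv_snd]; exact hq2
  obtain ⟨U, hUd, hUc, g', hg', j, hj, hjg⟩ := big_open hBC 𝒴.str (q ≫ 𝒴.base.inv ≫ pullback.fst 𝒴.str (sK B)) (by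
    intro p hp hmin
    obtain ⟨φ, hφ1, hφ2⟩ := phi_exists hAC hsA 𝒳 P hP p hmin
    refine ⟨pullback.lift φ (sI (hC1C.trans (le_locAt C p))) (by rw [hφ1, sI_sI]) ≫ g, ?_, ?_⟩
    · rw [Category.assoc, hg1, pullback.lift_snd_assoc, sI_sI]
    · have : sK (locAt C p) ≫ pullback.lift φ (sI (hC1C.trans (le_locAt C p))) (by rw [hφ1, sI_sI]) =
          q ≫ 𝒳.base.inv ≫ bcMapK 𝒳.str hAC1 := by
        apply pullback.hom_ext
        · rw [Category.assoc, pullback.lift_fst, Category.assoc, Category.assoc, bcMapK_fst, hφ2]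
          exact hq1.symm
        · rw [Category.assoc, pullback.lift_snd, Category.assoc, Category.assoc, bcMapK_snd, sK_sI,
            ← Category.assoc 𝒳.base.inv, 𝒳.base_inv_snd, ← Category.assoc, hqX, Category.id_comp]
      rw [← Category.assoc, this, Category.assoc, Category.assoc, hg2, Iso.inv_hom_id_assoc])
  obtain ⟨s, ⟨hs1, hs2⟩, -⟩ := hY (SR C) (sI hBC) (smooth_sI hBC hsB)
    ((HasRingHomProperty.Spec_iff (P := @LocallyOfFiniteType)).mpr (ft_incl hBC hC))
    inferInstance inferInstance inferInstance U hUd hUc g' hg'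
  refine ⟨pullback.lift s (𝟙 _) (by rw [hs1, Category.id_comp]), pullback.lift_snd _ _ _, q, ?_, ?_, hx⟩
  · have h1 : (𝒴.bc hBC).base.inv ≫ pullback.fst (𝒴.bc hBC).str (sK C) = 𝒴.base.inv ≫ bcMapK 𝒴.str hBC := by
      change (𝒴.base.inv ≫ (isPullback_bcMapK 𝒴.str hBC).isoPullback.hom) ≫ pullback.fst (pullback.snd 𝒴.str (sI hBC)) (sK C) = _
      rw [Category.assoc, IsPullback.isoPullback_hom_fst]
    have h2 : q ≫ 𝒴.base.inv ≫ bcMapK 𝒴.str hBC =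
        sK C ≫ pullback.lift s (𝟙 _) (by rw [hs1, Category.id_comp]) := by
     apply pullback.hom_ext
     · rw [Category.assoc, Category.assoc, Category.assoc, bcMapK_fst, pullback.lift_fst, ← hj, Category.assoc, hs2, hjg]
     · rw [Category.assoc, Category.assoc, Category.assoc, bcMapK_snd, pullback.lift_snd, ← Category.assoc 𝒴.base.inv, 𝒴.base_inv_snd, ← Category.assoc, hqX,
        Category.id_comp, Category.comp_id]
    exact (congrArg (q ≫ ·) h1).trans h2
  · exact (congrArg (q ≫ ·) (𝒴.bc hBC).base_inv_snd).trans hqX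

/-- Let `k` be an algebraically closed field of characteristic zero, let
`X` be a variety over `k` with an arithmetically-pure model, and let `Δ ⊆ X` be a closed
subset. Then `X` is Mordellic modulo `Δ` over `k` if and only if `X` is arithmetically
hyperbolic modulo `Δ` over `k`. -/
theorem stmt_15 (k : Type) [Field k] [IsAlgClosed k] [CharZero k]
    (X : OverR k) (hX : IsVarietyOver X) (Δ : Set X.left) (hΔ : IsClosed Δ)
    (hpure : HasArithmeticallyPureModel k X) :
    MordellicModulo k X Δ ↔ ArithmeticallyHyperbolicModulo k X Δ := by
  exact ⟨easy_dir k X Δ, hard_dir k X Δ hpure⟩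

end
end
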